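/- arXiv:2101.03573 — 2 statements merged into one kernel-verified Lean document; each statement's English description precedes it below -/
import Mathlib

section
/- Let 𝐢 = (ι_1,…,ι_L) be a reduced word of the longest element w₀. Then for every 1 ≤ k ≤ L: (ν_k, β_l) ≥ 0 for all 1 ≤ l < k; (ν_k, β_k) = 1; and (ν_k, β_l) ≤ 0 for all k < l ≤ L. -/
open scoped BigOperators Classical

namespace QDatumPaper

structure CartanADE (J : Type) [Fintype J] [DecidableEq J] where
  a : J → J → ℤ
  symm : ∀ ι j : J, a ι j = a j ι
  diag : ∀ ι : J, a ι ι = 2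
  offDiag : ∀ ι j : J, ι ≠ j → a ι j = 0 ∨ a ι j = -1
  posDef : ∀ v : J → ℚ, v ≠ 0 → 0 < ∑ ι : J, ∑ j : J, v ι * (a ι j : ℚ) * v j
  indec : ∀ s : Set J, s.Nonempty →
    (∀ ι ∈ s, ∀ j : J, a ι j = -1 → j ∈ s) → s = Set.univ

variable {J : Type} [Fintype J] [DecidableEq J]

/-- `j` lies in the `σ`-orbit of `ι`. -/
def SameOrbit (σ : Equiv.Perm J) (ι j : J) : Prop := ∃ k : ℕ, (σ ^ k) ι = j

/-- The size `𝗌_{\barι}` of the `σ`-orbit of `ι`. -/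
noncomputable def orbitSize (σ : Equiv.Perm J) (ι : J) : ℕ :=
  ((Finset.range (orderOf σ)).image fun k => (σ ^ k) ι).card

/-- A diagram automorphism of the Cartan matrix `C`: no two distinct vertices in a common
orbit are adjacent. -/
structure DiagAut (C : CartanADE J) where
  σ : Equiv.Perm J
  compat : ∀ ι j : J, C.a (σ ι) (σ j) = C.a ι j
  noAdj : ∀ (ι : J) (k : ℕ), (σ ^ k) ι ≠ ι → C.a ι ((σ ^ k) ι) ≠ -1

/-- Height function on `(J, σ)`. -/
def IsHeightFunction (C : CartanADE J) (D : DiagAut C) (ξ : J → ℤ) : Prop :=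
  (∀ ι j : J, C.a ι j = -1 → orbitSize D.σ ι = orbitSize D.σ j →
      |ξ ι - ξ j| = (orbitSize D.σ ι : ℤ)) ∧
  (∀ ι j : J, C.a ι j = -1 → orbitSize D.σ ι < orbitSize D.σ j →
      ∃! j0 : J, SameOrbit D.σ j j0 ∧ |ξ ι - ξ j0| = 1 ∧
        ∀ k : ℕ, k < orderOf D.σ → ξ ((D.σ ^ k) j0) = ξ j0 - 2 * (k : ℤ))

/-- Symmetric bilinear form on the root lattice `ℤ^J`. -/
def pairing (C : CartanADE J) (v w : J → ℤ) : ℤ := ∑ ι : J, ∑ j : J, v ι * C.a ι j * w j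

/-- Positive roots. -/
def posRoots (C : CartanADE J) : Set (J → ℤ) :=
  {v | (∀ ι : J, 0 ≤ v ι) ∧ v ≠ 0 ∧ pairing C v v = 2}

def simpleRoot (ι : J) : J → ℤ := fun j => if j = ι then 1 else 0

/-- Simple reflection `s_ι` on the root lattice. -/
def reflS (C : CartanADE J) (ι : J) (v : J → ℤ) : J → ℤ :=
  fun j => v j - (∑ κ : J, v κ * C.a κ ι) * simpleRoot ι j

/-- `applyRefls C [ι₁, …, ι_m] v = s_{ι₁}(s_{ι₂}(⋯ s_{ι_m}(v)⋯))`. -/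
def applyRefls (C : CartanADE J) (w : List J) (v : J → ℤ) : J → ℤ :=
  w.foldr (reflS C) v

/-- `β_k = s_{ι₁} ⋯ s_{ι_{k-1}} (α_{ι_k})`. -/
def betaOf (C : CartanADE J) {L : ℕ} (ii : Fin L → J) (k : Fin L) : J → ℤ :=
  applyRefls C ((List.ofFn ii).take k.1) (simpleRoot (ii k))

/-- `ii` is a reduced word of the longest element. -/
def IsReducedWord (C : CartanADE J) {L : ℕ} (ii : Fin L → J) : Prop :=
  L = (posRoots C).ncard ∧ Function.Injective (betaOf C ii) ∧
    ∀ k : Fin L, betaOf C ii k ∈ posRoots C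

def pairingQ (C : CartanADE J) (v w : J → ℚ) : ℚ :=
  ∑ ι : J, ∑ j : J, v ι * (C.a ι j : ℚ) * w j

def reflQ (C : CartanADE J) (ι : J) (v : J → ℚ) : J → ℚ :=
  fun j => v j - (∑ κ : J, v κ * (C.a κ ι : ℚ)) * (if j = ι then 1 else 0)

def applyReflsQ (C : CartanADE J) (w : List J) (v : J → ℚ) : J → ℚ :=
  w.foldr (reflQ C) v

/-- `Λ` is a system of fundamental weights: `(Λ_ι, α_j) = δ_{ιj}`. -/
def IsFundWeights (C : CartanADE J) (Λ : J → J → ℚ) : Prop :=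
  ∀ ι j : J, pairingQ C (Λ ι) (fun κ => (simpleRoot j κ : ℚ)) = if ι = j then 1 else 0

/-- `ν_k = -(s_{ι₁} ⋯ s_{ι_k})(Λ_{ι_k})`. -/
def nuOf (C : CartanADE J) {L : ℕ} (ii : Fin L → J) (Λ : J → J → ℚ) (k : Fin L) : J → ℚ :=
  - applyReflsQ C ((List.ofFn ii).take (k.1 + 1)) (Λ (ii k))

def betaQ (C : CartanADE J) {L : ℕ} (ii : Fin L → J) (k : Fin L) : J → ℚ :=
  fun j => (betaOf C ii k j : ℚ)

/-- The pairing `(ν_k, β_t)`. -/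
def nuBetaPair (C : CartanADE J) {L : ℕ} (ii : Fin L → J) (Λ : J → J → ℚ) (k t : Fin L) : ℚ :=
  pairingQ C (nuOf C ii Λ k) (betaQ C ii t)

/-- `m` is a Kostant partition of `β`. -/
def IsKP (C : CartanADE J) (β : J → ℤ) (m : (J → ℤ) → ℤ) : Prop :=
  (∀ v : J → ℤ, v ∉ posRoots C → m v = 0) ∧ (∀ v ∈ posRoots C, 0 ≤ m v) ∧
    ∑ᶠ v ∈ posRoots C, m v • v = β

/-- `ρ^ii(m)_r = Σ_{t ≤ r} m(β_t)(ν_r, β_t)`. -/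
def rhoOf (C : CartanADE J) {L : ℕ} (ii : Fin L → J) (Λ : J → J → ℚ)
    (m : (J → ℤ) → ℤ) (r : Fin L) : ℚ :=
  ∑ t ∈ Finset.univ.filter (fun t : Fin L => t ≤ r),
    (m (betaOf C ii t) : ℚ) * nuBetaPair C ii Λ r t

/-- The partial order `≼_ii` on Kostant partitions. -/
def kpLE (C : CartanADE J) {L : ℕ} (ii : Fin L → J) (Λ : J → J → ℚ)
    (m n : (J → ℤ) → ℤ) : Prop :=
  ∀ r : Fin L, rhoOf C ii Λ m r ≤ rhoOf C ii Λ n r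

/-- The height function obtained from `ξ` by applying sources `w = [ι₁, …, ι_k]`. -/
noncomputable def heightAfter (σ : Equiv.Perm J) (ξ : J → ℤ) (w : List J) : J → ℤ :=
  w.foldl (fun η ι => fun j => η j - if j = ι then 2 * (orbitSize σ ι : ℤ) else 0) ξ

def IsSource (C : CartanADE J) (ξ : J → ℤ) (ι : J) : Prop :=
  ∀ j : J, C.a ι j = -1 → ξ j < ξ ι

/-- `ii` is adapted to the Q-datum `(J, σ, ξ)`. -/
def IsAdapted (C : CartanADE J) (D : DiagAut C) (ξ : J → ℤ) {L : ℕ} (ii : Fin L → J) : Prop :=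
  ∀ k : Fin L, IsSource C (heightAfter D.σ ξ ((List.ofFn ii).take k.1)) (ii k)

/-- `(s_{ι_{k-1}} ⋯ s_{ι_1} ξ)_{ι_k}`, the second component of `Ω̃_Q(β_k)`. -/
noncomputable def heightAt (σ : Equiv.Perm J) (ξ : J → ℤ) {L : ℕ} (ii : Fin L → J) (k : Fin L) : ℤ :=
  heightAfter σ ξ ((List.ofFn ii).take k.1) (ii k)

/-- `x ∈ Im Ω̃_Q`. -/
def InImOmega (σ : Equiv.Perm J) (ξ : J → ℤ) {L : ℕ} (ii : Fin L → J) (x : J × ℤ) : Prop :=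
  ∃ k : Fin L, ii k = x.1 ∧ heightAt σ ξ ii k = x.2

/-- A single commutation move. -/
def CommStep (C : CartanADE J) {L : ℕ} (ii jj : Fin L → J) : Prop :=
  ∃ (k : ℕ) (h1 : k < L) (h2 : k + 1 < L),
    C.a (ii ⟨k, h1⟩) (ii ⟨k + 1, h2⟩) = 0 ∧
    jj = ii ∘ Equiv.swap (⟨k, h1⟩ : Fin L) ⟨k + 1, h2⟩

/-- Commutation equivalence of words. -/
def CommEquiv (C : CartanADE J) {L : ℕ} (ii jj : Fin L → J) : Prop :=
  Relation.ReflTransGen (CommStep C) ii jj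

/-- The orbits of `ι` and `j` are adjacent (`\barι ∼ \barj` in `I₀`). -/
def adjOrbit (C : CartanADE J) (σ : Equiv.Perm J) (ι j : J) : Prop :=
  ∃ ι' j' : J, SameOrbit σ ι ι' ∧ SameOrbit σ j j' ∧ C.a ι' j' = -1

/-- `c ι j` is the Cartan matrix `c_{\barι \barj}` of the folded algebra `𝔤₀`. -/
noncomputable def IsFoldedCartan (C : CartanADE J) (σ : Equiv.Perm J) (c : J → J → ℤ) : Prop :=
  ∀ ι j : J, (c ι j : ℚ) =
    if SameOrbit σ ι j then 2
    else if adjOrbit C σ ι j then -(max 1 ((orbitSize σ j : ℚ) / (orbitSize σ ι : ℚ)))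
    else 0

/-- The basis element `ϖ_{\barι, p}` of `𝒫_ℤ`, realized as a function on `J × ℤ`
(the indicator of `orbit(ι) × {p}`). -/
noncomputable def varpiF (σ : Equiv.Perm J) (ι : J) (p : ℤ) : (J × ℤ) → ℤ :=
  fun y => if SameOrbit σ ι y.1 ∧ y.2 = p then 1 else 0

/-- The ℓ-root `α_{\barι, p}`. -/
noncomputable def lrootF (σ : Equiv.Perm J) (c : J → J → ℤ) (ι : J) (p : ℤ) : (J × ℤ) → ℤ :=
  fun y => varpiF σ ι (p + (orbitSize σ ι : ℤ)) y + varpiF σ ι (p - (orbitSize σ ι : ℤ)) y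
    - (if (¬ SameOrbit σ ι y.1) ∧
          ∃ k : ℤ, 1 ≤ k ∧ k ≤ -(c y.1 ι) ∧ y.2 = p - c y.1 ι + 1 - 2 * k
       then 1 else 0)

/-- `(\barι, p + 𝗌_{\barι}) ∈ Î₀`, i.e. the index `(\barι,p)` gives a valid ℓ-root. -/
def ValidLRootIdx (σ : Equiv.Perm J) (ξ : J → ℤ) (ι : J) (p : ℤ) : Prop :=
  (2 : ℤ) ∣ (p + (orbitSize σ ι : ℤ) - ξ ι)

/-- The set of all ℓ-roots (generating `𝒬_ℤ`). -/
noncomputable def lrootSet (σ : Equiv.Perm J) (ξ : J → ℤ) (c : J → J → ℤ) :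
    Set ((J × ℤ) → ℤ) :=
  {x | ∃ (ι : J) (p : ℤ), ValidLRootIdx σ ξ ι p ∧ x = lrootF σ c ι p}

/-- The ℤ-linear map `Ω_Q : ℤ^{R⁺} → 𝒫_ℤ`. -/
noncomputable def OmegaQmap (C : CartanADE J) (σ : Equiv.Perm J) (ξ : J → ℤ) {L : ℕ}
    (ii : Fin L → J) (m : (J → ℤ) → ℤ) : (J × ℤ) → ℤ :=
  ∑ k : Fin L, m (betaOf C ii k) • varpiF σ (ii k) (heightAt σ ξ ii k)

/-! ### Helper lemmas -/

lemma aux_sum (C : CartanADE J) (ι : J) (v : J → ℤ) :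
    pairing C v (simpleRoot ι) = ∑ κ : J, v κ * C.a κ ι := by
  simp [pairing, simpleRoot]

lemma pairing_comm' (C : CartanADE J) (v w : J → ℤ) : pairing C v w = pairing C w v := by
  unfold pairing
  rw [Finset.sum_comm]
  refine Finset.sum_congr rfl fun i _ => Finset.sum_congr rfl fun j _ => ?_
  rw [C.symm j i]; ring

lemma pairing_sub_smul (C : CartanADE J) (v w u : J → ℤ) (c : ℤ) :
    pairing C (fun j => v j - c * w j) u = pairing C v u - c * pairing C w u := by
  simp only [pairing, Finset.mul_sum, ← Finset.sum_sub_distrib]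
  refine Finset.sum_congr rfl fun i _ => Finset.sum_congr rfl fun j _ => ?_
  ring

lemma pairing_simple (C : CartanADE J) (ι : J) :
    pairing C (simpleRoot ι) (simpleRoot ι) = 2 := by
  rw [aux_sum]; simp [simpleRoot, C.diag]

lemma reflS_def' (C : CartanADE J) (ι : J) (v : J → ℤ) :
    reflS C ι v = fun j => v j - pairing C v (simpleRoot ι) * simpleRoot ι j := by
  rw [aux_sum]; rfl

/-- The square of `v - c w` in terms of the form. -/
lemma pairing_sq (C : CartanADE J) (v w : J → ℤ) (c : ℤ) :
    pairing C (fun j => v j - c * w j) (fun j => v j - c * w j)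
      = pairing C v v - 2 * c * pairing C v w + c ^ 2 * pairing C w w := by
  rw [pairing_sub_smul, pairing_comm' C v, pairing_comm' C w, pairing_sub_smul, pairing_sub_smul,
    pairing_comm' C w v]
  ring

lemma reflS_norm (C : CartanADE J) (ι : J) (v : J → ℤ) :
    pairing C (reflS C ι v) (reflS C ι v) = pairing C v v := by
  rw [reflS_def', pairing_sq, pairing_simple]; ring

lemma reflS_invol (C : CartanADE J) (ι : J) (v : J → ℤ) :
    reflS C ι (reflS C ι v) = v := by
  rw [reflS_def' C ι (reflS C ι v), reflS_def' C ι v, pairing_sub_smul, pairing_simple]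
  funext j; ring

lemma reflS_neg (C : CartanADE J) (ι : J) (v : J → ℤ) :
    reflS C ι (-v) = - reflS C ι v := by
  funext j
  simp only [reflS, Pi.neg_apply, neg_mul, Finset.sum_neg_distrib]
  ring

lemma reflS_simple (C : CartanADE J) (ι : J) :
    reflS C ι (simpleRoot ι) = - simpleRoot ι := by
  rw [reflS_def', pairing_simple]
  funext j; simp only [Pi.neg_apply]; ring

lemma pairing_pos (C : CartanADE J) (v : J → ℤ) (hv : v ≠ 0) : 0 < pairing C v v := by
  have h := C.posDef (fun j => (v j : ℚ)) (by
    intro h; apply hv; funext j; have := congrFun h j; simpa using this)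
  have e : ((pairing C v v : ℤ) : ℚ)
      = ∑ ι : J, ∑ j : J, (v ι : ℚ) * (C.a ι j : ℚ) * (v j : ℚ) := by
    simp [pairing]
  rw [← e] at h
  exact_mod_cast h

lemma reflS_pos (C : CartanADE J) (ι : J) (v : J → ℤ) (hv : v ∈ posRoots C)
    (hne : v ≠ simpleRoot ι) : reflS C ι v ∈ posRoots C := by
  obtain ⟨h0, hv0, h2⟩ := hv
  have hn : pairing C (reflS C ι v) (reflS C ι v) = 2 := by rw [reflS_norm, h2]
  -- the part of `v` off `ι`
  set u : J → ℤ := fun j => v j - v ι * simpleRoot ι j with hu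
  have hu0 : ∀ j, 0 ≤ u j := by
    intro j
    by_cases hj : j = ι
    · subst hj; simp [hu, simpleRoot]
    · simpa [hu, simpleRoot, hj] using h0 j
  have huι : u ι = 0 := by simp [hu, simpleRoot]
  have hune : u ≠ 0 := by
    intro h
    have hvj : v = fun j => (0 : J → ℤ) j - (- v ι) * simpleRoot ι j := by
      funext j
      have := congrFun h j
      simp only [hu, Pi.zero_apply] at this ⊢
      linarith
    have hz : ∀ w, pairing C (0 : J → ℤ) w = 0 := by intro w; simp [pairing]
    have : pairing C v v = v ι ^ 2 * 2 := by
      conv_lhs => rw [hvj]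
      rw [pairing_sq, pairing_simple, hz, hz]; ring
    have h1 : v ι = 1 := by
      have := h0 ι
      nlinarith
    apply hne
    rw [hvj, h1]; funext j; simp
  have hup := pairing_pos C u hune
  have huα : pairing C u (simpleRoot ι) ≤ 0 := by
    rw [aux_sum]
    refine Finset.sum_nonpos fun κ _ => ?_
    by_cases hκ : κ = ι
    · subst hκ; simp [huι]
    · rcases C.offDiag κ ι hκ with h | h <;> rw [h] <;> have := hu0 κ <;> linarith
  have hr : reflS C ι v
      = fun j => u j - (pairing C v (simpleRoot ι) - v ι) * simpleRoot ι j := by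
    rw [reflS_def']; funext j; simp only [hu]; ring
  set c := pairing C v (simpleRoot ι) - v ι with hc
  have hc0 : c ≤ 0 := by
    by_contra hcp
    push Not at hcp
    rw [hr, pairing_sq, pairing_simple] at hn
    nlinarith
  refine ⟨?_, ?_, hn⟩
  · intro j
    rw [hr]
    have h1 : (0 : ℤ) ≤ simpleRoot ι j := by unfold simpleRoot; split_ifs <;> norm_num
    have := hu0 j
    simp only
    nlinarith
  · intro h
    rw [h] at hn
    simp [pairing] at hn

/-! ### Undoing a prefix of the word -/

/-- `s_{ι_a} ⋯ s_{ι_1}` applied to `v`. -/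
def undo (C : CartanADE J) {L : ℕ} (ii : Fin L → J) (a : ℕ) (v : J → ℤ) : J → ℤ :=
  applyRefls C ((List.ofFn ii).take a).reverse v

lemma undo_zero (C : CartanADE J) {L : ℕ} (ii : Fin L → J) (v : J → ℤ) :
    undo C ii 0 v = v := by simp [undo, applyRefls]

lemma take_succ_ofFn {L : ℕ} (ii : Fin L → J) (a : Fin L) :
    (List.ofFn ii).take (a.1 + 1) = (List.ofFn ii).take a.1 ++ [ii a] := by
  rw [List.take_succ_eq_append_getElem (by simp)]
  simp

lemma undo_succ (C : CartanADE J) {L : ℕ} (ii : Fin L → J) (a : Fin L) (v : J → ℤ) :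
    undo C ii (a.1 + 1) v = reflS C (ii a) (undo C ii a.1 v) := by
  simp [undo, applyRefls, take_succ_ofFn]

lemma applyRefls_reverse (C : CartanADE J) (w : List J) (v : J → ℤ) :
    applyRefls C w.reverse (applyRefls C w v) = v := by
  induction w with
  | nil => simp [applyRefls]
  | cons x w ih =>
    have : applyRefls C (x :: w).reverse (applyRefls C (x :: w) v)
        = applyRefls C w.reverse (reflS C x (reflS C x (applyRefls C w v))) := by
      simp [applyRefls]
    rw [this, reflS_invol, ih]

lemma undo_inj (C : CartanADE J) {L : ℕ} (ii : Fin L → J) (a : ℕ) (v w : J → ℤ)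
    (h : undo C ii a v = undo C ii a w) : v = w := by
  have h' := congrArg (applyRefls C ((List.ofFn ii).take a).reverse.reverse) h
  unfold undo at h'
  rwa [applyRefls_reverse, applyRefls_reverse] at h'

lemma applyRefls_neg (C : CartanADE J) (w : List J) (v : J → ℤ) :
    applyRefls C w (-v) = - applyRefls C w v := by
  induction w with
  | nil => simp [applyRefls]
  | cons x w ih =>
    have e : ∀ u, applyRefls C (x :: w) u = reflS C x (applyRefls C w u) := fun u => rfl
    rw [e, e, ih, reflS_neg]

lemma undo_beta_self (C : CartanADE J) {L : ℕ} (ii : Fin L → J) (l : Fin L) :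
    undo C ii l.1 (betaOf C ii l) = simpleRoot (ii l) := by
  unfold undo betaOf; rw [applyRefls_reverse]

lemma undo_pos (C : CartanADE J) {L : ℕ} (ii : Fin L → J) (hii : IsReducedWord C ii)
    (l : Fin L) (a : ℕ) (ha : a ≤ l.1) : undo C ii a (betaOf C ii l) ∈ posRoots C := by
  induction a with
  | zero => rw [undo_zero]; exact hii.2.2 l
  | succ a ih =>
    have haL : a < L := by have := l.2; omega
    have e := undo_succ C ii ⟨a, haL⟩ (betaOf C ii l)
    simp only at e
    rw [e]
    refine reflS_pos C _ _ (ih (by omega)) ?_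
    intro h
    have h1 := undo_beta_self C ii ⟨a, haL⟩
    have h2 := hii.2.1 (undo_inj C ii a _ _ (h.trans h1.symm))
    have h3 := congrArg Fin.val h2
    simp only at h3
    omega

lemma undo_negPos (C : CartanADE J) {L : ℕ} (ii : Fin L → J) (hii : IsReducedWord C ii)
    (l : Fin L) (a : ℕ) (ha : l.1 + 1 ≤ a) (haL : a ≤ L) :
    - undo C ii a (betaOf C ii l) ∈ posRoots C := by
  induction a, ha using Nat.le_induction with
  | base =>
    rw [undo_succ, undo_beta_self, reflS_simple, neg_neg]
    have := undo_pos C ii hii l l.1 le_rfl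
    rwa [undo_beta_self] at this
  | succ a ha ih =>
    have haL' : a < L := by omega
    have e := undo_succ C ii ⟨a, haL'⟩ (betaOf C ii l)
    simp only at e
    rw [e, ← reflS_neg]
    refine reflS_pos C _ _ (ih (by omega)) ?_
    intro h
    have h1 := undo_beta_self C ii ⟨a, haL'⟩
    have h2 : undo C ii a (- betaOf C ii l) = undo C ii a (betaOf C ii ⟨a, haL'⟩) := by
      rw [h1, ← h]; unfold undo; rw [applyRefls_neg]
    have h3 := undo_inj C ii a _ _ h2
    obtain ⟨p1, p2, -⟩ := hii.2.2 l
    obtain ⟨q1, -, -⟩ := hii.2.2 ⟨a, haL'⟩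
    apply p2
    funext j
    have := p1 j
    have := q1 j
    rw [← h3] at this
    simp only [Pi.neg_apply, Pi.zero_apply] at *
    omega

/-! ### Rational side -/

lemma pairingQ_reflQ (C : CartanADE J) (ι : J) (v : J → ℚ) (w : J → ℤ) :
    pairingQ C (reflQ C ι v) (fun j => (w j : ℚ))
      = pairingQ C v (fun j => (reflS C ι w j : ℚ)) := by
  have h1 : pairingQ C (reflQ C ι v) (fun j => (w j : ℚ))
      = pairingQ C v (fun j => (w j : ℚ))
        - (∑ κ : J, v κ * (C.a κ ι : ℚ)) * ∑ j : J, (C.a ι j : ℚ) * (w j : ℚ) := by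
    simp only [pairingQ, reflQ, sub_mul, Finset.sum_sub_distrib]
    congr 1
    rw [Finset.sum_eq_single ι]
    · simp [Finset.mul_sum, mul_assoc]
    · intro b _ hb; simp [hb]
    · simp
  have h2 : pairingQ C v (fun j => (reflS C ι w j : ℚ))
      = pairingQ C v (fun j => (w j : ℚ))
        - (∑ κ : J, v κ * (C.a κ ι : ℚ)) * ∑ j : J, (w j : ℚ) * (C.a j ι : ℚ) := by
    simp only [pairingQ, reflS, simpleRoot, Int.cast_sub, mul_sub, Finset.sum_sub_distrib]
    congr 1
    rw [Finset.sum_mul]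
    refine Finset.sum_congr rfl fun i _ => ?_
    rw [Finset.sum_eq_single ι]
    · simp
    · intro b _ hb; simp [hb]
    · simp
  rw [h1, h2]
  congr 2
  refine Finset.sum_congr rfl fun j _ => ?_
  rw [C.symm ι j]; ring

lemma pairingQ_applyReflsQ (C : CartanADE J) (l : List J) (v : J → ℚ) (w : J → ℤ) :
    pairingQ C (applyReflsQ C l v) (fun j => (w j : ℚ))
      = pairingQ C v (fun j => (applyRefls C l.reverse w j : ℚ)) := by
  induction l generalizing w with
  | nil => simp [applyReflsQ, applyRefls]
  | cons x l ih =>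
    have e : applyReflsQ C (x :: l) v = reflQ C x (applyReflsQ C l v) := rfl
    rw [e, pairingQ_reflQ, ih]
    simp [applyRefls]

lemma pairingQ_fund (C : CartanADE J) (Λ : J → J → ℚ) (hΛ : IsFundWeights C Λ) (ι : J)
    (w : J → ℤ) : pairingQ C (Λ ι) (fun j => (w j : ℚ)) = w ι := by
  have h : ∀ j, ∑ i : J, Λ ι i * (C.a i j : ℚ) = if ι = j then 1 else 0 := by
    intro j
    rw [← hΛ ι j]
    simp [pairingQ, simpleRoot]
  unfold pairingQ
  rw [Finset.sum_comm]
  simp only [← Finset.sum_mul, h]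
  simp

lemma nuBetaPair_eq (C : CartanADE J) {L : ℕ} (ii : Fin L → J) (Λ : J → J → ℚ)
    (hΛ : IsFundWeights C Λ) (k l : Fin L) :
    nuBetaPair C ii Λ k l = - ((undo C ii (k.1 + 1) (betaOf C ii l) (ii k) : ℤ) : ℚ) := by
  have hneg : ∀ v w : J → ℚ, pairingQ C (-v) w = - pairingQ C v w := by
    intro v w; simp [pairingQ, Finset.sum_neg_distrib]
  unfold nuBetaPair nuOf betaQ
  rw [hneg, pairingQ_applyReflsQ, pairingQ_fund C Λ hΛ]
  rfl

/-- McNamara: for a reduced word `(ι_1, …, ι_L)` of `w₀` and every `k`,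
`(ν_k, β_l) ≥ 0` for `l < k`, `(ν_k, β_k) = 1`, and `(ν_k, β_l) ≤ 0` for `l > k`. -/
theorem statement7 (C : CartanADE J) (L : ℕ) (ii : Fin L → J)
    (hii : IsReducedWord C ii) (Λ : J → J → ℚ) (hΛ : IsFundWeights C Λ) :
    ∀ k : Fin L,
      (∀ l : Fin L, l < k → 0 ≤ nuBetaPair C ii Λ k l) ∧
      nuBetaPair C ii Λ k k = 1 ∧
      (∀ l : Fin L, k < l → nuBetaPair C ii Λ k l ≤ 0) := by
  intro k
  refine ⟨fun l hl => ?_, ?_, fun l hl => ?_⟩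
  · rw [nuBetaPair_eq C ii Λ hΛ]
    have h := (undo_negPos C ii hii l (k.1 + 1) (by have : l.1 < k.1 := hl; omega) k.2).1 (ii k)
    rw [Pi.neg_apply] at h
    exact_mod_cast h
  · rw [nuBetaPair_eq C ii Λ hΛ, undo_succ, undo_beta_self, reflS_simple]
    simp [simpleRoot]
  · rw [nuBetaPair_eq C ii Λ hΛ]
    have h := (undo_pos C ii hii l (k.1 + 1) hl).1 (ii k)
    have h' : (0 : ℚ) ≤ (undo C ii (k.1 + 1) (betaOf C ii l) (ii k) : ℤ) := by exact_mod_cast h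
    linarith

end QDatumPaper
end

section
/- Let Q = (J,σ,ξ) be a Q-datum and 𝐢 a reduced word of w₀ adapted to Q. Then 𝒫_Q ∩ 𝒬_ℤ = Σ_{(i,p)∈K̂} ℤ·α_{i,p}; that is, an element of 𝒫_ℤ lies both in the image of Ω_Q and in the subgroup generated by all ℓ-roots if and only if it is a ℤ-linear combination of the ℓ-roots α_{i,p} with (i,p) ∈ K̂. -/
open scoped BigOperators Classical

namespace QDatumPaper

variable {J : Type} [Fintype J] [DecidableEq J]

set_option linter.unusedSectionVars false

/-! ### Orbits -/

theorem so_iff (σ : Equiv.Perm J) (ι j : J) : SameOrbit σ ι j ↔ σ.SameCycle ι j := by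
  constructor
  · rintro ⟨k, hk⟩
    exact ⟨k, by simpa using hk⟩
  · intro h
    obtain ⟨k, -, hk⟩ := h.exists_pow_eq'
    exact ⟨k, hk⟩

theorem so_refl (σ : Equiv.Perm J) (ι : J) : SameOrbit σ ι ι := ⟨0, by simp⟩

theorem so_symm {σ : Equiv.Perm J} {ι j : J} (h : SameOrbit σ ι j) : SameOrbit σ j ι := by
  rw [so_iff] at *; exact h.symm

theorem so_trans {σ : Equiv.Perm J} {ι j k : J} (h : SameOrbit σ ι j) (h' : SameOrbit σ j k) :
    SameOrbit σ ι k := by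
  rw [so_iff] at *; exact h.trans h'

theorem minPer_dvd (σ : Equiv.Perm J) (ι : J) : Function.minimalPeriod σ ι ∣ orderOf σ := by
  apply Function.IsPeriodicPt.minimalPeriod_dvd
  rw [Function.IsPeriodicPt, Function.IsFixedPt, Equiv.Perm.iterate_eq_pow, pow_orderOf_eq_one]
  rfl

theorem minPer_pos (σ : Equiv.Perm J) (ι : J) : 0 < Function.minimalPeriod σ ι :=
  Nat.pos_of_dvd_of_pos (minPer_dvd σ ι) (orderOf_pos σ)

theorem orbitSize_eq (σ : Equiv.Perm J) (ι : J) :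
    orbitSize σ ι = Function.minimalPeriod σ ι := by
  have himg : ((Finset.range (orderOf σ)).image fun k => (σ ^ k) ι) =
      ((Finset.range (Function.minimalPeriod σ ι)).image fun k => (σ ^ k) ι) := by
    ext x
    simp only [Finset.mem_image, Finset.mem_range]
    constructor
    · rintro ⟨k, -, hk⟩
      refine ⟨k % Function.minimalPeriod σ ι, Nat.mod_lt _ (minPer_pos σ ι), ?_⟩
      rw [← hk, ← Equiv.Perm.iterate_eq_pow, ← Equiv.Perm.iterate_eq_pow,
        Function.iterate_mod_minimalPeriod_eq]
    · rintro ⟨k, hk, hx⟩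
      exact ⟨k, lt_of_lt_of_le hk (Nat.le_of_dvd (orderOf_pos σ) (minPer_dvd σ ι)), hx⟩
  unfold orbitSize
  rw [himg, Finset.card_image_of_injOn, Finset.card_range]
  intro a ha b hb hab
  simp only [Finset.coe_range, Set.mem_Iio] at ha hb
  simp only [← Equiv.Perm.iterate_eq_pow] at hab
  exact Function.iterate_injOn_Iio_minimalPeriod ha hb hab

theorem os_pos (σ : Equiv.Perm J) (ι : J) : 0 < orbitSize σ ι := by
  rw [orbitSize_eq]; exact minPer_pos σ ι

theorem os_dvd (σ : Equiv.Perm J) (ι : J) : orbitSize σ ι ∣ orderOf σ := by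
  rw [orbitSize_eq]; exact minPer_dvd σ ι

theorem pow_fix_iff (σ : Equiv.Perm J) (ι : J) (k : ℕ) :
    (σ ^ k) ι = ι ↔ orbitSize σ ι ∣ k := by
  rw [orbitSize_eq, ← Function.isPeriodicPt_iff_minimalPeriod_dvd, Function.IsPeriodicPt,
    Function.IsFixedPt, Equiv.Perm.iterate_eq_pow]

theorem os_pow (σ : Equiv.Perm J) (ι : J) (k : ℕ) :
    orbitSize σ ((σ ^ k) ι) = orbitSize σ ι := by
  have h : ∀ m, orbitSize σ ((σ ^ k) ι) ∣ m ↔ orbitSize σ ι ∣ m := by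
    intro m
    rw [← pow_fix_iff, ← pow_fix_iff, ← Equiv.Perm.mul_apply, ← pow_add, add_comm, pow_add,
      Equiv.Perm.mul_apply]
    exact (σ ^ k).injective.eq_iff
  exact Nat.dvd_antisymm ((h _).2 dvd_rfl) ((h _).1 dvd_rfl)

theorem os_so {σ : Equiv.Perm J} {ι j : J} (h : SameOrbit σ ι j) :
    orbitSize σ ι = orbitSize σ j := by
  obtain ⟨k, rfl⟩ := h; rw [os_pow]

theorem so_lt {σ : Equiv.Perm J} {ι j : J} (h : SameOrbit σ ι j) :
    ∃ k < orderOf σ, (σ ^ k) ι = j := by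
  obtain ⟨k, rfl⟩ := h
  exact ⟨k % orderOf σ, Nat.mod_lt _ (orderOf_pos σ), by rw [pow_mod_orderOf]⟩

theorem os_one {σ : Equiv.Perm J} {ι j : J} (h : SameOrbit σ ι j) (h1 : orbitSize σ ι = 1) :
    j = ι := by
  obtain ⟨k, rfl⟩ := h
  rw [pow_fix_iff, h1]; exact one_dvd k

theorem orbit_card (σ : Equiv.Perm J) (ι : J) :
    (Finset.univ.filter fun j => SameOrbit σ ι j).card = orbitSize σ ι := by
  unfold orbitSize
  congr 1
  ext x
  simp only [Finset.mem_filter, Finset.mem_univ, true_and, Finset.mem_image, Finset.mem_range]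
  exact ⟨fun h => so_lt h, fun ⟨k, _, h⟩ => ⟨k, h⟩⟩

theorem a_pow {C : CartanADE J} (D : DiagAut C) (k : ℕ) (ι j : J) :
    C.a ((D.σ ^ k) ι) ((D.σ ^ k) j) = C.a ι j := by
  induction k with
  | zero => simp
  | succ n ih => rw [pow_succ', Equiv.Perm.mul_apply, Equiv.Perm.mul_apply, D.compat, ih]

/-- Adjacency between orbits can be rotated to start at a given vertex. -/
theorem adj_rot {C : CartanADE J} (D : DiagAut C) {ι ι' j' : J} (h : SameOrbit D.σ ι' ι)
    (hadj : C.a ι' j' = -1) : ∃ j, SameOrbit D.σ j' j ∧ C.a ι j = -1 := by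
  obtain ⟨k, rfl⟩ := h
  exact ⟨(D.σ ^ k) j', ⟨k, rfl⟩, by rw [a_pow, hadj]⟩

theorem a_orbit {C : CartanADE J} (D : DiagAut C) {ι j : J} (h : SameOrbit D.σ ι j) :
    C.a ι j = if j = ι then 2 else 0 := by
  obtain ⟨k, rfl⟩ := h
  split_ifs with h
  · rw [h, C.diag]
  · rcases C.offDiag ι _ (Ne.symm h) with h' | h'
    · exact h'
    · exact absurd h' (D.noAdj ι k h)

theorem adj_not_so {C : CartanADE J} (D : DiagAut C) {ι j : J} (h : C.a ι j = -1) :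
    ¬ SameOrbit D.σ ι j := by
  intro h'
  rw [a_orbit D h'] at h
  split_ifs at h

/-! ### The quadratic form on sets of vertices -/

/-- Sum of the Cartan matrix over a set of vertices. -/
def Aset (C : CartanADE J) (S : Finset J) : ℤ := ∑ ι ∈ S, ∑ j ∈ S, C.a ι j

theorem ind_sum (C : CartanADE J) (S T : Finset J) :
    (∑ ι : J, ∑ j : J, (if ι ∈ S then (1 : ℚ) else 0) * (C.a ι j : ℚ) *
      (if j ∈ T then 1 else 0)) = ((∑ ι ∈ S, ∑ j ∈ T, C.a ι j : ℤ) : ℚ) := by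
  push_cast
  simp only [ite_mul, one_mul, zero_mul, mul_ite, mul_one, mul_zero]
  rw [← Finset.sum_filter_add_sum_filter_not Finset.univ (fun ι => ι ∈ S)]
  rw [Finset.sum_eq_zero (s := Finset.univ.filter fun ι => ι ∉ S)]
  · rw [add_zero, Finset.filter_mem_eq_inter, Finset.univ_inter]
    refine Finset.sum_congr rfl fun ι hι => ?_
    simp [hι]
  · intro ι hι
    simp only [Finset.mem_filter] at hι
    simp [hι.2]

theorem Aset_pos (C : CartanADE J) (S : Finset J) (hS : S.Nonempty) : 0 < Aset C S := by
  obtain ⟨x, hx⟩ := hS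
  have h := C.posDef (fun ι => if ι ∈ S then 1 else 0) (by
    intro h0
    have := congrFun h0 x
    simp [hx] at this)
  rw [ind_sum] at h
  exact_mod_cast h

theorem Aset_insert (C : CartanADE J) (T : Finset J) (j : J) (hj : j ∉ T) :
    Aset C (insert j T) = Aset C T + 2 + 2 * ∑ ι ∈ T, C.a ι j := by
  unfold Aset
  rw [Finset.sum_insert hj, Finset.sum_insert hj]
  have : ∀ ι ∈ T, ∑ k ∈ insert j T, C.a ι k = C.a ι j + ∑ k ∈ T, C.a ι k := fun ι _ =>
    Finset.sum_insert hj
  rw [Finset.sum_congr rfl this, Finset.sum_add_distrib, C.diag,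
    Finset.sum_congr rfl fun k _ => C.symm j k]
  ring

theorem Aset_univ_le (C : CartanADE J) (x : J) : Aset C Finset.univ ≤ 2 := by
  obtain ⟨T, hT, hmax⟩ := Finset.exists_max_image
    (Finset.univ.filter fun T : Finset J => T.Nonempty ∧ Aset C T ≤ 2) Finset.card
    ⟨{x}, Finset.mem_filter.2 ⟨Finset.mem_univ _, Finset.singleton_nonempty x, by simp [Aset, C.diag]⟩⟩
  simp only [Finset.mem_filter, Finset.mem_univ, true_and] at hT hmax
  have huniv : (T : Set J) = Set.univ := by
    apply C.indec _ (by exact_mod_cast hT.1)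
    intro ι hι j hij
    by_contra hj
    simp only [Finset.mem_coe] at hι hj
    have h1 := hmax (insert j T) ⟨⟨j, by simp⟩, by
      rw [Aset_insert C T j hj]
      have : ∑ ι ∈ T, C.a ι j ≤ -1 := by
        rw [← Finset.add_sum_erase _ _ hι, hij]
        have : ∑ k ∈ T.erase ι, C.a k j ≤ 0 := by
          apply Finset.sum_nonpos
          intro k hk
          have hkT := Finset.mem_of_mem_erase hk
          rcases C.offDiag k j (fun h => hj (h ▸ hkT)) with h | h <;> omega
        omega
      have := hT.2
      omega⟩
    rw [Finset.card_insert_of_notMem hj] at h1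
    omega
  have : T = Finset.univ := by
    ext y; simpa using (Set.ext_iff.1 huniv y)
  rw [← this]; exact hT.2

theorem exists_fixed_aux {C : CartanADE J} (D : DiagAut C) : ∀ (n : ℕ) (S : Finset J),
    S.card ≤ n → S.Nonempty → (∀ ι ∈ S, ∀ j, SameOrbit D.σ ι j → j ∈ S) → Aset C S ≤ 2 →
    ∃ f, orbitSize D.σ f = 1 := by
  intro n
  induction n with
  | zero =>
    intro S hc hS
    have := hS.card_pos
    omega
  | succ n ih =>
    intro S hc hS hinv hA
    have hpos := Aset_pos C S hS
    obtain ⟨v, hv, hd⟩ : ∃ v ∈ S, 0 < ∑ j ∈ S, C.a v j := by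
      by_contra hcon
      push Not at hcon
      have : Aset C S ≤ 0 := Finset.sum_nonpos hcon
      omega
    set d := ∑ j ∈ S, C.a v j with hdef
    have hd2 : d ≤ 2 := by
      rw [hdef, ← Finset.add_sum_erase _ _ hv, C.diag]
      have : ∑ k ∈ S.erase v, C.a v k ≤ 0 := by
        apply Finset.sum_nonpos
        intro k hk
        rcases C.offDiag v k (Finset.ne_of_mem_erase hk).symm with h | h <;> omega
      omega
    set O : Finset J := Finset.univ.filter fun j => SameOrbit D.σ v j with hO
    have hOS : O ⊆ S := by
      intro j hj
      simp only [hO, Finset.mem_filter, Finset.mem_univ, true_and] at hj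
      exact hinv v hv j hj
    have hmap : ∀ k : ℕ, S.map ((D.σ ^ k).toEmbedding) = S := by
      intro k
      apply Finset.eq_of_subset_of_card_le
      · intro y hy
        simp only [Finset.mem_map_equiv] at hy
        have := hinv _ hy y ⟨k, by simp⟩
        exact this
      · simp
    have hrow : ∀ u ∈ O, ∑ j ∈ S, C.a u j = d := by
      intro u hu
      simp only [hO, Finset.mem_filter, Finset.mem_univ, true_and] at hu
      obtain ⟨k, rfl⟩ := hu
      rw [← hmap k, Finset.sum_map]
      simp only [Equiv.coe_toEmbedding]
      exact Finset.sum_congr rfl fun j _ => a_pow D k v j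
    have hsplit : Aset C (S \ O) = Aset C S - 2 * (O.card * d) + 2 * O.card := by
      have e1 : ∑ u ∈ O, ∑ j ∈ S, C.a u j = O.card * d := by
        rw [Finset.sum_congr rfl hrow]; simp
      have e2 : ∑ u ∈ S, ∑ j ∈ O, C.a u j = O.card * d := by
        rw [Finset.sum_comm, ← e1]
        exact Finset.sum_congr rfl fun u _ => Finset.sum_congr rfl fun j _ => C.symm j u
      have e3 : ∑ u ∈ O, ∑ j ∈ O, C.a u j = 2 * O.card := by
        have : ∀ u ∈ O, ∑ j ∈ O, C.a u j = 2 := by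
          intro u hu
          have hu' := hu
          simp only [hO, Finset.mem_filter, Finset.mem_univ, true_and] at hu'
          rw [Finset.sum_congr rfl (g := fun j => if j = u then (2 : ℤ) else 0)]
          · simp [hu]
          · intro j hj
            simp only [hO, Finset.mem_filter, Finset.mem_univ, true_and] at hj
            exact a_orbit D (so_trans (so_symm hu') hj)
        rw [Finset.sum_congr rfl this]; simp; ring
      have hs : ∀ f : J → ℤ, ∑ u ∈ S \ O, f u = ∑ u ∈ S, f u - ∑ u ∈ O, f u := fun f => by
        rw [← Finset.sum_sdiff hOS]; ring
      unfold Aset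
      rw [hs]
      simp only [hs, Finset.sum_sub_distrib]
      rw [e1, e2, e3]; ring
    have hOpos : 0 < O.card := Finset.card_pos.2 ⟨v, by simp [hO, so_refl]⟩
    have hOc : O.card = orbitSize D.σ v := orbit_card D.σ v
    have hcard : (S \ O).card < S.card := by
      rw [Finset.card_sdiff_of_subset hOS]
      have := Finset.card_le_card hOS
      omega
    have hdd : d = 1 ∨ d = 2 := by omega
    by_cases hne : (S \ O).Nonempty
    · have hp' := Aset_pos C _ hne
      rcases hdd with h1 | h2
      · apply ih (S \ O) (by omega) hne
        · intro ι hι j hj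
          simp only [Finset.mem_sdiff] at hι ⊢
          refine ⟨hinv ι hι.1 j hj, fun hjO => hι.2 ?_⟩
          simp only [hO, Finset.mem_filter, Finset.mem_univ, true_and] at hjO ⊢
          exact so_trans hjO (so_symm hj)
        · rw [hsplit, h1]; omega
      · rw [hsplit, h2] at hp'; omega
    · rw [Finset.not_nonempty_iff_eq_empty] at hne
      rw [hne] at hsplit
      have h0 : Aset C (∅ : Finset J) = 0 := by simp [Aset]
      rw [h0] at hsplit
      refine ⟨v, ?_⟩
      rcases hdd with h1 | h2
      · rw [h1] at hsplit; omega
      · rw [h2] at hsplit; omega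

theorem exists_fixed {C : CartanADE J} (D : DiagAut C) (x : J) :
    ∃ f, orbitSize D.σ f = 1 :=
  exists_fixed_aux D _ Finset.univ le_rfl ⟨x, Finset.mem_univ x⟩
    (fun _ _ _ _ => Finset.mem_univ _) (Aset_univ_le C x)

/-! ### Sizes of adjacent orbits -/

theorem os_big {C : CartanADE J} {D : DiagAut C} {ξ : J → ℤ} (hξ : IsHeightFunction C D ξ)
    {ι j : J} (h : C.a ι j = -1) (hlt : orbitSize D.σ ι < orbitSize D.σ j) :
    orbitSize D.σ j = orderOf D.σ := by
  obtain ⟨j0, ⟨hso, -, hk⟩, -⟩ := hξ.2 ι j h hlt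
  rw [os_so hso]
  by_contra hne
  have hle := Nat.le_of_dvd (orderOf_pos D.σ) (os_dvd D.σ j0)
  have h1 := hk (orbitSize D.σ j0) (by omega)
  rw [(pow_fix_iff D.σ j0 _).2 dvd_rfl] at h1
  have := os_pos D.σ j0
  omega

theorem orbit_double_sum {C : CartanADE J} (D : DiagAut C) (v : J) :
    (∑ u ∈ Finset.univ.filter (fun j => SameOrbit D.σ v j),
      ∑ j ∈ Finset.univ.filter (fun j => SameOrbit D.σ v j), C.a u j)
      = 2 * (orbitSize D.σ v : ℤ) := by
  have : ∀ u ∈ Finset.univ.filter (fun j => SameOrbit D.σ v j),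
      ∑ j ∈ Finset.univ.filter (fun j => SameOrbit D.σ v j), C.a u j = 2 := by
    intro u hu
    have hu' := hu
    simp only [Finset.mem_filter, Finset.mem_univ, true_and] at hu'
    rw [Finset.sum_congr rfl (g := fun j => if j = u then (2 : ℤ) else 0)]
    · simp [hu']
    · intro j hj
      simp only [Finset.mem_filter, Finset.mem_univ, true_and] at hj
      exact a_orbit D (so_trans (so_symm hu') hj)
  rw [Finset.sum_congr rfl this, Finset.sum_const, orbit_card]
  simp; ring

theorem os_ratio {C : CartanADE J} (D : DiagAut C) {ι j : J} (h : C.a ι j = -1) (r : ℕ)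
    (hr : orbitSize D.σ j = r * orbitSize D.σ ι) : r < 4 := by
  set O := Finset.univ.filter (fun k => SameOrbit D.σ ι k) with hO
  set P := Finset.univ.filter (fun k => SameOrbit D.σ j k) with hP
  have hno : ¬ SameOrbit D.σ ι j := adj_not_so D h
  have hιO : ι ∈ O := by simp [hO, so_refl]
  have hjO : j ∉ O := by simp [hO, hno]
  have hjP : j ∈ P := by simp [hP, so_refl]
  have hpos := C.posDef (fun k => (r : ℚ) * (if k ∈ O then 1 else 0) +
    2 * (if k ∈ P then 1 else 0)) (by
      intro h0
      have := congrFun h0 j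
      simp [hjO, hjP] at this)
  have hexp : (∑ u : J, ∑ k : J, ((r : ℚ) * (if u ∈ O then 1 else 0) +
      2 * (if u ∈ P then 1 else 0)) * (C.a u k : ℚ) * ((r : ℚ) * (if k ∈ O then 1 else 0) +
      2 * (if k ∈ P then 1 else 0))) =
      (r : ℚ) ^ 2 * (∑ u : J, ∑ k : J, (if u ∈ O then (1 : ℚ) else 0) * (C.a u k : ℚ) *
        (if k ∈ O then 1 else 0)) +
      2 * r * (∑ u : J, ∑ k : J, (if u ∈ O then (1 : ℚ) else 0) * (C.a u k : ℚ) *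
        (if k ∈ P then 1 else 0)) +
      2 * r * (∑ u : J, ∑ k : J, (if u ∈ P then (1 : ℚ) else 0) * (C.a u k : ℚ) *
        (if k ∈ O then 1 else 0)) +
      4 * (∑ u : J, ∑ k : J, (if u ∈ P then (1 : ℚ) else 0) * (C.a u k : ℚ) *
        (if k ∈ P then 1 else 0)) := by
    simp only [Finset.mul_sum, ← Finset.sum_add_distrib]
    refine Finset.sum_congr rfl fun u _ => Finset.sum_congr rfl fun k _ => ?_
    ring
  rw [hexp, ind_sum, ind_sum, ind_sum, ind_sum, hO, hP, orbit_double_sum, orbit_double_sum,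
    ← hO, ← hP] at hpos
  have hsym : ∑ u ∈ O, ∑ k ∈ P, C.a u k = ∑ u ∈ P, ∑ k ∈ O, C.a u k := by
    rw [Finset.sum_comm]
    exact Finset.sum_congr rfl fun u _ => Finset.sum_congr rfl fun k _ => C.symm k u
  rw [hsym] at hpos
  have hX : ∑ u ∈ P, ∑ k ∈ O, C.a u k ≤ -(orbitSize D.σ j : ℤ) := by
    rw [← orbit_card, ← hP]
    have : ∀ u ∈ P, ∑ k ∈ O, C.a u k ≤ -1 := by
      intro u hu
      simp only [hP, Finset.mem_filter, Finset.mem_univ, true_and] at hu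
      obtain ⟨k, hk, hk1⟩ := adj_rot D hu (by rw [C.symm]; exact h : C.a j ι = -1)
      have hkO : k ∈ O := by simp [hO, hk]
      rw [← Finset.add_sum_erase _ _ hkO, hk1]
      have : ∑ l ∈ O.erase k, C.a u l ≤ 0 := by
        apply Finset.sum_nonpos
        intro l hl
        have hlO := Finset.mem_of_mem_erase hl
        simp only [hO, Finset.mem_filter, Finset.mem_univ, true_and] at hlO
        rcases C.offDiag u l (fun e => hno (so_trans hlO (so_symm (e ▸ hu)))) with h | h <;> omega
      omega
    calc _ ≤ ∑ u ∈ P, (-1 : ℤ) := Finset.sum_le_sum this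
      _ = _ := by simp
  set X := ∑ u ∈ P, ∑ k ∈ O, C.a u k
  have hs := os_pos D.σ ι
  have hpos' : 0 < (r : ℤ) ^ 2 * (2 * (orbitSize D.σ ι : ℤ)) + 2 * r * X + 2 * r * X +
      4 * (2 * (orbitSize D.σ j : ℤ)) := by exact_mod_cast hpos
  have hr' : (orbitSize D.σ j : ℤ) = r * orbitSize D.σ ι := by exact_mod_cast hr
  by_contra hcon
  push Not at hcon
  have hs' : (0 : ℤ) < orbitSize D.σ ι := by exact_mod_cast hs
  have hr4 : (4 : ℤ) ≤ r := by exact_mod_cast hcon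
  rw [hr'] at hpos' hX
  have h1 : (r : ℤ) * X ≤ r * -(r * orbitSize D.σ ι) := by gcongr
  nlinarith [mul_nonneg (mul_nonneg (by omega : (0 : ℤ) ≤ r) hs'.le) (by omega : (0 : ℤ) ≤ r - 4)]

theorem os_small {C : CartanADE J} {D : DiagAut C} {ξ : J → ℤ} (hξ : IsHeightFunction C D ξ)
    {ι j : J} (h : C.a ι j = -1) (hlt : orbitSize D.σ ι < orbitSize D.σ j) :
    orbitSize D.σ ι = 1 := by
  obtain ⟨f, hf⟩ := exists_fixed D ι
  have hset := C.indec {κ | ∃ r : ℕ, r < 4 ∧ orderOf D.σ = r * orbitSize D.σ κ} ⟨j, 1, by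
      norm_num, by rw [os_big hξ h hlt]; ring⟩ (by
    rintro u ⟨r, hr, hru⟩ k huk
    rcases lt_trichotomy (orbitSize D.σ u) (orbitSize D.σ k) with h1 | h1 | h1
    · exact ⟨1, by norm_num, by rw [os_big hξ huk h1]; ring⟩
    · exact ⟨r, hr, by rw [← h1]; exact hru⟩
    · have huk' : C.a k u = -1 := by rw [C.symm]; exact huk
      obtain ⟨t, ht⟩ := os_dvd D.σ k
      refine ⟨t, os_ratio D huk' t ?_, by rw [ht]; ring⟩
      rw [os_big hξ huk' h1, ht]; ring)
  have hfm : f ∈ {κ | ∃ r : ℕ, r < 4 ∧ orderOf D.σ = r * orbitSize D.σ κ} := by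
    rw [hset]; trivial
  obtain ⟨r, hr, hrf⟩ := hfm
  rw [hf, mul_one] at hrf
  have h2 := os_dvd D.σ ι
  rw [os_big hξ h hlt, hrf] at hlt
  rw [hrf] at h2
  have := os_pos D.σ ι
  interval_cases r <;> try omega
  have h3 : orbitSize D.σ ι = 1 ∨ orbitSize D.σ ι = 2 := by omega
  rcases h3 with h3 | h3
  · exact h3
  · rw [h3] at h2; omega

/-! ### Residues of heights -/

theorem residue {C : CartanADE J} {D : DiagAut C} {ξ : J → ℤ} (hξ : IsHeightFunction C D ξ)
    (ι : J) (k : ℕ) : (2 * (orbitSize D.σ ι : ℤ)) ∣ ξ ((D.σ ^ k) ι) - ξ ι + 2 * k := by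
  have hone : ∀ ι, orbitSize D.σ ι = 1 → ∀ k : ℕ,
      (2 * (orbitSize D.σ ι : ℤ)) ∣ ξ ((D.σ ^ k) ι) - ξ ι + 2 * k := by
    intro ι h1 k
    rw [(pow_fix_iff D.σ ι k).2 (by rw [h1]; exact one_dvd k), h1]
    exact ⟨k, by push_cast; ring⟩
  obtain ⟨f, hf⟩ := exists_fixed D ι
  have hset := C.indec {κ | ∀ k : ℕ,
      (2 * (orbitSize D.σ κ : ℤ)) ∣ ξ ((D.σ ^ k) κ) - ξ κ + 2 * k} ⟨f, hone f hf⟩ (by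
    intro u hu j huj
    rcases lt_trichotomy (orbitSize D.σ u) (orbitSize D.σ j) with h1 | h1 | h1
    · intro k
      obtain ⟨j0, ⟨hso, -, hk⟩, -⟩ := hξ.2 u j huj h1
      have hn := os_big hξ huj h1
      rw [hn]
      obtain ⟨l, hl, rfl⟩ := so_lt (so_symm hso)
      rw [hk l hl, ← Equiv.Perm.mul_apply, ← pow_add, ← pow_mod_orderOf,
        hk _ (Nat.mod_lt _ (orderOf_pos _))]
      have := Nat.mod_add_div (k + l) (orderOf D.σ)
      refine ⟨((k + l) / orderOf D.σ : ℕ), ?_⟩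
      have h' : (((k + l) % orderOf D.σ : ℕ) : ℤ) +
          (orderOf D.σ : ℤ) * ((k + l) / orderOf D.σ : ℕ) = k + l := by exact_mod_cast this
      linear_combination (-2) * h'
    · intro k
      have e1 := hξ.1 u j huj h1
      have e2 := hξ.1 ((D.σ ^ k) u) ((D.σ ^ k) j) (by rw [a_pow, huj])
        (by rw [os_pow, os_pow, h1])
      rw [os_pow] at e2
      have e3 := hu k
      rw [h1] at e1 e2 e3
      obtain ⟨t, ht⟩ := e3
      have hs : (0 : ℤ) ≤ orbitSize D.σ j := by positivity
      rcases (abs_eq hs).1 e1 with e1 | e1 <;> rcases (abs_eq hs).1 e2 with e2 | e2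
      · exact ⟨t, by linear_combination ht + e1 - e2⟩
      · exact ⟨t + 1, by linear_combination ht + e1 - e2⟩
      · exact ⟨t - 1, by linear_combination ht + e1 - e2⟩
      · exact ⟨t, by linear_combination ht + e1 - e2⟩
    · exact hone j (os_small hξ (by rw [C.symm]; exact huj) h1))
  have : ι ∈ {κ | ∀ k : ℕ,
      (2 * (orbitSize D.σ κ : ℤ)) ∣ ξ ((D.σ ^ k) κ) - ξ κ + 2 * k} := by rw [hset]; trivial
  exact this k

theorem residue_inj {C : CartanADE J} {D : DiagAut C} {ξ : J → ℤ} (hξ : IsHeightFunction C D ξ)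
    {ι j : J} (h : SameOrbit D.σ ι j) (hd : (2 * (orbitSize D.σ ι : ℤ)) ∣ ξ j - ξ ι) : j = ι := by
  obtain ⟨k, rfl⟩ := h
  rw [pow_fix_iff]
  have h1 := (dvd_add_right hd).1 (residue hξ ι k)
  exact_mod_cast (mul_dvd_mul_iff_left (two_ne_zero : (2 : ℤ) ≠ 0)).1 h1

theorem residue_ex {C : CartanADE J} {D : DiagAut C} {ξ : J → ℤ} (hξ : IsHeightFunction C D ξ)
    {ι : J} {q : ℤ} (h : (2 : ℤ) ∣ q - ξ ι) :
    ∃ j, SameOrbit D.σ ι j ∧ (2 * (orbitSize D.σ j : ℤ)) ∣ q - ξ j := by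
  obtain ⟨d, hd⟩ := h
  have hs : (0 : ℤ) < orbitSize D.σ ι := by exact_mod_cast os_pos D.σ ι
  obtain ⟨k, hk⟩ := Int.eq_ofNat_of_zero_le (Int.emod_nonneg (-d) hs.ne')
  refine ⟨(D.σ ^ k) ι, ⟨k, rfl⟩, ?_⟩
  rw [os_pow]
  obtain ⟨t, ht⟩ := residue hξ ι k
  have h2 := Int.emod_add_mul_ediv (-d) (orbitSize D.σ ι)
  rw [hk] at h2
  refine ⟨-t - (-d) / (orbitSize D.σ ι : ℤ), ?_⟩
  linear_combination hd - ht + 2 * h2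

/-- Weak form of the height function conditions, stable under source reflections. -/
def HH (C : CartanADE J) (D : DiagAut C) (η : J → ℤ) : Prop :=
  ∀ ι j, C.a ι j = -1 →
    (orbitSize D.σ ι = orbitSize D.σ j → |η ι - η j| = (orbitSize D.σ ι : ℤ)) ∧
    (orbitSize D.σ ι < orbitSize D.σ j → η j ≤ η ι + 1 ∧
      η ι + 1 - 2 * (orbitSize D.σ j : ℤ) ≤ η j ∧ (2 : ℤ) ∣ η j - η ι - 1)

theorem HH_init {C : CartanADE J} {D : DiagAut C} {ξ : J → ℤ} (hξ : IsHeightFunction C D ξ) :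
    HH C D ξ := by
  intro ι j h
  refine ⟨hξ.1 ι j h, fun hlt => ?_⟩
  obtain ⟨j0, ⟨hso, habs, hk⟩, -⟩ := hξ.2 ι j h hlt
  have hn := os_big hξ h hlt
  obtain ⟨l, hl, rfl⟩ := so_lt (so_symm hso)
  rw [hn, hk l hl]
  rcases (abs_eq zero_le_one).1 habs with e | e
  · exact ⟨by omega, by omega, by omega⟩
  · exact ⟨by omega, by omega, by omega⟩

theorem HH_step {C : CartanADE J} {D : DiagAut C} {ξ η : J → ℤ} (hξ : IsHeightFunction C D ξ)
    (hη : HH C D η) {κ : J} (hκ : IsSource C η κ) :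
    HH C D (fun j => η j - if j = κ then 2 * (orbitSize D.σ κ : ℤ) else 0) := by
  intro ι j h
  have hne : ι ≠ j := by
    rintro rfl
    rw [C.diag] at h; omega
  obtain ⟨h1, h2⟩ := hη ι j h
  have h' : C.a j ι = -1 := by rw [C.symm]; exact h
  have hs : (0 : ℤ) ≤ orbitSize D.σ ι := by positivity
  by_cases hι : ι = κ
  · subst hι
    have hj := hκ j h
    simp only [if_true, if_neg hne.symm]
    refine ⟨fun e => ?_, fun hlt => ?_⟩
    · have h3 := h1 e
      rw [abs_eq hs] at h3 ⊢
      right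
      rcases h3 with h3 | h3 <;> omega
    · have h4 := h2 hlt
      rw [os_small hξ h hlt]
      refine ⟨?_, ?_, ?_⟩ <;> push_cast <;> omega
  · by_cases hj : j = κ
    · subst hj
      have hj := hκ ι h'
      simp only [if_true, if_neg hne]
      refine ⟨fun e => ?_, fun hlt => ?_⟩
      · have h3 := h1 e
        rw [abs_eq hs] at h3 ⊢
        left
        rw [← e]
        rcases h3 with h3 | h3 <;> omega
      · have h4 := h2 hlt
        refine ⟨?_, ?_, ?_⟩ <;> omega
    · simp only [if_neg hι, if_neg hj, sub_zero]
      exact ⟨h1, h2⟩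

/-! ### Heights along the word -/

/-- Height function after `k` steps. -/
noncomputable def hgt (σ : Equiv.Perm J) (ξ : J → ℤ) {L : ℕ} (ii : Fin L → J) (k : ℕ) : J → ℤ :=
  heightAfter σ ξ ((List.ofFn ii).take k)

theorem hgt_succ (σ : Equiv.Perm J) (ξ : J → ℤ) {L : ℕ} (ii : Fin L → J) (k : Fin L) :
    hgt σ ξ ii (k.1 + 1) = fun j => hgt σ ξ ii k.1 j -
      if j = ii k then 2 * (orbitSize σ (ii k) : ℤ) else 0 := by
  unfold hgt heightAfter
  have : (List.ofFn ii).take (k.1 + 1) = (List.ofFn ii).take k.1 ++ [ii k] := by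
    rw [List.take_add_one]
    simp
  rw [this, List.foldl_append]
  rfl

theorem hgt_HH {C : CartanADE J} {D : DiagAut C} {ξ : J → ℤ} (hξ : IsHeightFunction C D ξ)
    {L : ℕ} {ii : Fin L → J} (ha : IsAdapted C D ξ ii) :
    ∀ k ≤ L, HH C D (hgt D.σ ξ ii k) := by
  intro k
  induction k with
  | zero => intro _; exact HH_init hξ
  | succ k ih =>
    intro hk
    have := hgt_succ D.σ ξ ii ⟨k, hk⟩
    simp only at this
    rw [this]
    exact HH_step hξ (ih (by omega)) (ha ⟨k, hk⟩)

theorem hgt_mem (σ : Equiv.Perm J) (ξ : J → ℤ) {L : ℕ} (ii : Fin L → J) (ι : J) :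
    ∀ k ≤ L, (2 * (orbitSize σ ι : ℤ)) ∣ hgt σ ξ ii k ι - ξ ι ∧ hgt σ ξ ii k ι ≤ ξ ι ∧
      ∀ q : ℤ, ((2 * (orbitSize σ ι : ℤ)) ∣ q - ξ ι ∧ hgt σ ξ ii k ι < q ∧ q ≤ ξ ι) ↔
      ∃ l : Fin L, l.1 < k ∧ ii l = ι ∧ hgt σ ξ ii l.1 ι = q := by
  intro k
  induction k with
  | zero =>
    intro _
    have h0 : hgt σ ξ ii 0 = ξ := by simp [hgt, heightAfter]
    rw [h0]
    refine ⟨by simp, le_rfl, fun q => ⟨fun h => by omega, ?_⟩⟩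
    rintro ⟨l, hl, _⟩
    omega
  | succ k ih =>
    intro hk
    obtain ⟨h1, h2, h3⟩ := ih (by omega)
    have hs := hgt_succ σ ξ ii ⟨k, hk⟩
    simp only at hs
    have hp : (0 : ℤ) < orbitSize σ ι := by exact_mod_cast os_pos σ ι
    rw [hs]
    by_cases he : ι = ii ⟨k, hk⟩
    · simp only [← he, if_true]
      refine ⟨?_, by omega, fun q => ⟨?_, ?_⟩⟩
      · obtain ⟨t, ht⟩ := h1
        exact ⟨t - 1, by linear_combination ht⟩
      · rintro ⟨hq, hlt, hle⟩
        by_cases hq2 : hgt σ ξ ii k ι < q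
        · obtain ⟨l, hl, hl2⟩ := (h3 q).1 ⟨hq, hq2, hle⟩
          exact ⟨l, by omega, hl2⟩
        · refine ⟨⟨k, hk⟩, by simp, he.symm, ?_⟩
          simp only
          obtain ⟨t, ht⟩ : (2 * (orbitSize σ ι : ℤ)) ∣ hgt σ ξ ii k ι - q := by
            obtain ⟨t, ht⟩ := h1
            obtain ⟨t', ht'⟩ := hq
            exact ⟨t - t', by linear_combination ht - ht'⟩
          have ht0 : 0 ≤ t := by
            by_contra hcon
            nlinarith
          have ht1 : t < 1 := by
            by_contra hcon
            nlinarith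
          have : t = 0 := by omega
          rw [this] at ht
          omega
      · rintro ⟨l, hl, hl1, hl2⟩
        by_cases hlk : l.1 < k
        · have := (h3 q).2 ⟨l, hlk, hl1, hl2⟩
          exact ⟨this.1, by omega, this.2.2⟩
        · have hlk : l.1 = k := by omega
          rw [hlk] at hl2
          subst hl2
          exact ⟨h1, by omega, h2⟩
    · simp only [if_neg he, sub_zero]
      refine ⟨h1, h2, fun q => ?_⟩
      rw [h3 q]
      constructor
      · rintro ⟨l, hl, hl2⟩
        exact ⟨l, by omega, hl2⟩
      · rintro ⟨l, hl, hl1, hl2⟩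
        refine ⟨l, ?_, hl1, hl2⟩
        by_contra hcon
        have : l = ⟨k, hk⟩ := Fin.ext (by simp only; omega)
        rw [this] at hl1
        exact he hl1.symm

theorem im_iff (σ : Equiv.Perm J) (ξ : J → ℤ) {L : ℕ} (ii : Fin L → J) (ι : J) (q : ℤ) :
    InImOmega σ ξ ii (ι, q) ↔
      (2 * (orbitSize σ ι : ℤ)) ∣ q - ξ ι ∧ hgt σ ξ ii L ι < q ∧ q ≤ ξ ι := by
  rw [(hgt_mem σ ξ ii ι L le_rfl).2.2 q]
  constructor
  · rintro ⟨k, hk, hq⟩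
    simp only at hk hq
    refine ⟨k, k.2, hk, ?_⟩
    rw [← hq, ← hk]; rfl
  · rintro ⟨k, -, hk, hq⟩
    refine ⟨k, hk, ?_⟩
    simp only
    rw [← hq, ← hk]; rfl

theorem heightAt_inj (σ : Equiv.Perm J) (ξ : J → ℤ) {L : ℕ} (ii : Fin L → J) (k l : Fin L)
    (h : ii k = ii l) (hh : heightAt σ ξ ii k = heightAt σ ξ ii l) : k = l := by
  have key : ∀ k l : Fin L, k < l → ii k = ii l →
      heightAt σ ξ ii k = heightAt σ ξ ii l → False := by
    intro k l hkl h hh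
    have h1 := ((hgt_mem σ ξ ii (ii l) l.1 l.2.le).2.2 (heightAt σ ξ ii k)).2
      ⟨k, hkl, h, by rw [← h]; rfl⟩
    have h2 : heightAt σ ξ ii l = hgt σ ξ ii l.1 (ii l) := rfl
    omega
  rcases lt_trichotomy k l with h1 | h1 | h1
  · exact (key k l h1 h hh).elim
  · exact h1
  · exact (key l k h1 h.symm hh.symm).elim

/-! ### ℓ-roots -/

theorem c_orbit {C : CartanADE J} {D : DiagAut C} {c : J → J → ℤ} (hc : IsFoldedCartan C D.σ c)
    {ι ι' j j' : J} (h : SameOrbit D.σ ι ι') (h' : SameOrbit D.σ j j') : c ι j = c ι' j' := by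
  have e1 : SameOrbit D.σ ι j ↔ SameOrbit D.σ ι' j' :=
    ⟨fun e => so_trans (so_symm h) (so_trans e h'), fun e => so_trans h (so_trans e (so_symm h'))⟩
  have e2 : adjOrbit C D.σ ι j ↔ adjOrbit C D.σ ι' j' := by
    constructor
    · rintro ⟨u, v, hu, hv, huv⟩
      exact ⟨u, v, so_trans (so_symm h) hu, so_trans (so_symm h') hv, huv⟩
    · rintro ⟨u, v, hu, hv, huv⟩
      exact ⟨u, v, so_trans h hu, so_trans h' hv, huv⟩
  have : (c ι j : ℚ) = (c ι' j' : ℚ) := by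
    rw [hc ι j, hc ι' j']
    simp only [e1, e2, os_so h, os_so h']
  exact_mod_cast this

theorem lroot_orbit {C : CartanADE J} {D : DiagAut C} {c : J → J → ℤ}
    (hc : IsFoldedCartan C D.σ c) {j j' : J} (h : SameOrbit D.σ j j') (r : ℤ) :
    lrootF D.σ c j r = lrootF D.σ c j' r := by
  funext y
  have e1 : SameOrbit D.σ j y.1 ↔ SameOrbit D.σ j' y.1 :=
    ⟨fun e => so_trans (so_symm h) e, fun e => so_trans h e⟩
  simp only [lrootF, varpiF, e1, os_so h, c_orbit hc (so_refl D.σ y.1) h]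

theorem lroot_invariant {C : CartanADE J} {D : DiagAut C} {c : J → J → ℤ}
    (hc : IsFoldedCartan C D.σ c) {ι ι' : J} (h : SameOrbit D.σ ι ι') (j : J) (r q : ℤ) :
    lrootF D.σ c j r (ι, q) = lrootF D.σ c j r (ι', q) := by
  have e1 : SameOrbit D.σ j ι ↔ SameOrbit D.σ j ι' :=
    ⟨fun e => so_trans e h, fun e => so_trans e (so_symm h)⟩
  simp only [lrootF, varpiF, e1, c_orbit hc h (so_refl D.σ j)]

theorem lroot_ne {σ : Equiv.Perm J} {c : J → J → ℤ} {j : J} {r : ℤ} {y : J × ℤ}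
    (h : lrootF σ c j r y ≠ 0) :
    (SameOrbit σ j y.1 ∧ y.2 = r + orbitSize σ j) ∨ (SameOrbit σ j y.1 ∧ y.2 = r - orbitSize σ j) ∨
    (¬ SameOrbit σ j y.1 ∧ ∃ k : ℤ, 1 ≤ k ∧ k ≤ -(c y.1 j) ∧ y.2 = r - c y.1 j + 1 - 2 * k) := by
  by_contra hcon
  push Not at hcon
  obtain ⟨h1, h2, h3⟩ := hcon
  apply h
  unfold lrootF varpiF
  rw [if_neg (fun e => h1 e.1 e.2), if_neg (fun e => h2 e.1 e.2), if_neg]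
  · rfl
  · rintro ⟨e, k, e1, e2, e3⟩
    exact h3 e k e1 e2 e3

theorem lroot_top (σ : Equiv.Perm J) (c : J → J → ℤ) (j : J) (r : ℤ) :
    lrootF σ c j r (j, r + orbitSize σ j) = 1 := by
  have := os_pos σ j
  have hne : ¬ (r + (orbitSize σ j : ℤ) = r - orbitSize σ j) := by omega
  simp [lrootF, varpiF, so_refl, hne]

theorem lroot_bot (σ : Equiv.Perm J) (c : J → J → ℤ) (j : J) (r : ℤ) :
    lrootF σ c j r (j, r - orbitSize σ j) = 1 := by
  have := os_pos σ j
  have hne : ¬ (r - (orbitSize σ j : ℤ) = r + orbitSize σ j) := by omega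
  simp [lrootF, varpiF, so_refl, hne]

/-- Description of the middle terms of an ℓ-root. -/
theorem middle {C : CartanADE J} {D : DiagAut C} {ξ : J → ℤ} (hξ : IsHeightFunction C D ξ)
    {c : J → J → ℤ} (hc : IsFoldedCartan C D.σ c) {j : J} {r : ℤ} {y : J × ℤ}
    (hg : (2 * (orbitSize D.σ j : ℤ)) ∣ r + orbitSize D.σ j - ξ j)
    (hns : ¬ SameOrbit D.σ j y.1) {k : ℤ} (hk1 : 1 ≤ k) (hk2 : k ≤ -(c y.1 j))
    (hy : y.2 = r - c y.1 j + 1 - 2 * k) :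
    ∃ ι, SameOrbit D.σ y.1 ι ∧ (2 * (orbitSize D.σ ι : ℤ)) ∣ y.2 - ξ ι ∧ C.a ι j = -1 ∧
      ((orbitSize D.σ ι = orbitSize D.σ j ∧ y.2 = r) ∨
       (orbitSize D.σ ι = 1 ∧ 1 < orbitSize D.σ j ∧ r - orbitSize D.σ j + 1 ≤ y.2 ∧
          y.2 ≤ r + orbitSize D.σ j - 1) ∨
       (orbitSize D.σ j = 1 ∧ 1 < orbitSize D.σ ι ∧ y.2 = r)) := by
  have hcy := hc y.1 j
  rw [if_neg (fun e => hns (so_symm e))] at hcy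
  by_cases hadj : adjOrbit C D.σ y.1 j
  swap
  · rw [if_neg hadj] at hcy
    have : c y.1 j = 0 := by exact_mod_cast hcy
    omega
  rw [if_pos hadj] at hcy
  obtain ⟨ι', j', hι', hj', ha⟩ := hadj
  have ha' : C.a j' ι' = -1 := by rw [C.symm]; exact ha
  obtain ⟨ι, hι, haι⟩ := adj_rot D (so_symm hj') ha'
  have hyι : SameOrbit D.σ y.1 ι := so_trans hι' hι
  have haι' : C.a ι j = -1 := by rw [C.symm]; exact haι
  have hsy := os_so hyι
  have hsyq : (0 : ℚ) < orbitSize D.σ y.1 := by exact_mod_cast os_pos D.σ y.1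
  have hle : orbitSize D.σ j ≤ orbitSize D.σ y.1 → c y.1 j = -1 := by
    intro hle
    rw [max_eq_left] at hcy
    · exact_mod_cast hcy
    · rw [div_le_one hsyq]; exact_mod_cast hle
  obtain ⟨g, hg⟩ := hg
  rcases lt_trichotomy (orbitSize D.σ ι) (orbitSize D.σ j) with h1 | h1 | h1
  · have hone := os_small hξ haι' h1
    obtain ⟨-, -, hpar⟩ := (HH_init hξ ι j haι').2 h1
    have hcv : c y.1 j = -(orbitSize D.σ j : ℤ) := by
      rw [hsy, hone, max_eq_right] at hcy
      · simp only [Nat.cast_one, div_one] at hcy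
        exact_mod_cast hcy
      · have := os_pos D.σ j
        simp only [Nat.cast_one, div_one]
        exact_mod_cast this
    rw [hcv] at hy hk2
    refine ⟨ι, hyι, ?_, haι', Or.inr (Or.inl ⟨hone, by omega, by omega, by omega⟩)⟩
    rw [hone]
    obtain ⟨t, ht⟩ := hpar
    exact ⟨orbitSize D.σ j * g + t + 1 - k, by push_cast; linear_combination hy + hg + ht⟩
  · have hcv := hle (by omega)
    rw [hcv] at hy hk2
    have hyr : y.2 = r := by omega
    refine ⟨ι, hyι, ?_, haι', Or.inl ⟨h1, hyr⟩⟩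
    have hab := hξ.1 ι j haι' h1
    rw [h1] at hab ⊢
    rcases (abs_eq (by positivity)).1 hab with e | e
    · exact ⟨g - 1, by linear_combination hyr + hg - e⟩
    · exact ⟨g, by linear_combination hyr + hg - e⟩
  · have hone := os_small hξ haι h1
    have hcv := hle (by omega)
    rw [hcv] at hy hk2
    have hyr : y.2 = r := by omega
    obtain ⟨-, -, hpar⟩ := (HH_init hξ j ι haι).2 h1
    obtain ⟨t, ht⟩ := hpar
    rw [hone] at hg
    obtain ⟨ι₂, hι₂, hd⟩ := residue_ex hξ (ι := ι) (q := y.2)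
      ⟨g - t - 1, by push_cast at hg; linear_combination hyr + hg - ht⟩
    refine ⟨ι₂, so_trans hyι hι₂, hd, ?_, Or.inr (Or.inr ⟨hone, ?_, hyr⟩)⟩
    · obtain ⟨l, rfl⟩ := hι₂
      have := a_pow D l ι j
      rw [(pow_fix_iff D.σ j l).2 (by rw [hone]; exact one_dvd l)] at this
      rw [this, haι']
    · rw [← os_so hι₂]; omega

theorem le_of_dvd_lt {s u v : ℤ} (hs : 0 < s) (hd : (2 * s) ∣ u - v) (h : u < v + 2 * s) :
    u ≤ v := by
  obtain ⟨t, ht⟩ := hd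
  have : t < 1 := by
    by_contra hcon
    nlinarith
  have : t ≤ 0 := by omega
  nlinarith

theorem main_range {C : CartanADE J} {D : DiagAut C} {ξ : J → ℤ} (hξ : IsHeightFunction C D ξ)
    {c : J → J → ℤ} (hc : IsFoldedCartan C D.σ c) {L : ℕ} {ii : Fin L → J}
    (hr : IsReducedWord C ii) (ha : IsAdapted C D ξ ii) {x : (J × ℤ) → ℤ}
    (hx : x ∈ AddSubgroup.closure
          {v : (J × ℤ) → ℤ | ∃ (ι : J) (p : ℤ),
            InImOmega D.σ ξ ii (ι, p - (orbitSize D.σ ι : ℤ)) ∧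
            InImOmega D.σ ξ ii (ι, p + (orbitSize D.σ ι : ℤ)) ∧
            v = lrootF D.σ c ι p}) :
    ∃ m : (J → ℤ) → ℤ, x = OmegaQmap C D.σ ξ ii m := by
  induction hx using AddSubgroup.closure_induction with
  | zero => exact ⟨0, by simp [OmegaQmap]⟩
  | add x y _ _ hx hy =>
    obtain ⟨m, rfl⟩ := hx
    obtain ⟨m', rfl⟩ := hy
    exact ⟨m + m', by simp [OmegaQmap, add_smul, Finset.sum_add_distrib]⟩
  | neg x _ hx =>
    obtain ⟨m, rfl⟩ := hx
    exact ⟨-m, by simp [OmegaQmap]⟩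
  | mem x hx =>
    obtain ⟨j, r, hlo, hhi, rfl⟩ := hx
    set v := lrootF D.σ c j r with hv
    have hlo' := (im_iff _ _ _ _ _).1 hlo
    have hhi' := (im_iff _ _ _ _ _).1 hhi
    have hζ := hgt_HH hξ ha L le_rfl
    set ζ := hgt D.σ ξ ii L with hζdef
    have hζj : (2 * (orbitSize D.σ j : ℤ)) ∣ ζ j - ξ j := (hgt_mem D.σ ξ ii j L le_rfl).1
    have hsj : (0 : ℤ) < orbitSize D.σ j := by exact_mod_cast os_pos D.σ j
    have hlo2 : ζ j + 2 * orbitSize D.σ j ≤ r - orbitSize D.σ j := by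
      by_contra hcon
      have hd : (2 * (orbitSize D.σ j : ℤ)) ∣ (r - orbitSize D.σ j) - ζ j := by
        obtain ⟨t, ht⟩ := hlo'.1
        obtain ⟨t', ht'⟩ := hζj
        exact ⟨t - t', by linear_combination ht - ht'⟩
      have := le_of_dvd_lt hsj hd (by omega)
      have := hlo'.2.1
      omega
    have hhi2 : r + orbitSize D.σ j ≤ ξ j := hhi'.2.2
    have hsupp : ∀ y : J × ℤ, v y ≠ 0 → ∃ k : Fin L, SameOrbit D.σ (ii k) y.1 ∧
        y.2 = heightAt D.σ ξ ii k := by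
      intro y hy
      rcases lroot_ne hy with ⟨h1, h2⟩ | ⟨h1, h2⟩ | ⟨hns, k, hk1, hk2, hk3⟩
      · obtain ⟨k, hk, hk'⟩ := hhi
        exact ⟨k, by rw [hk]; exact h1, by rw [hk', h2]⟩
      · obtain ⟨k, hk, hk'⟩ := hlo
        exact ⟨k, by rw [hk]; exact h1, by rw [hk', h2]⟩
      · obtain ⟨ι, hι, hd, hadj, hcase⟩ := middle hξ hc hhi'.1 hns hk1 hk2 hk3
        have hadj' : C.a j ι = -1 := by rw [C.symm]; exact hadj
        have hsι : (0 : ℤ) < orbitSize D.σ ι := by exact_mod_cast os_pos D.σ ι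
        have : InImOmega D.σ ξ ii (ι, y.2) := by
          rw [im_iff]
          refine ⟨hd, ?_⟩
          rw [← hζdef]
          rcases hcase with ⟨e1, e2⟩ | ⟨e1, e2, e3, e4⟩ | ⟨e1, e2, e3⟩
          · have g1 := abs_le.1 ((HH_init hξ ι j hadj).1 e1).le
            have g2 := abs_le.1 ((hζ ι j hadj).1 e1).le
            rw [e1] at g1 g2
            exact ⟨by omega, by omega⟩
          · have g1 := (HH_init hξ ι j hadj).2 (by omega)
            have g2 := (hζ ι j hadj).2 (by omega)
            exact ⟨by omega, by omega⟩
          · have g1 := (HH_init hξ j ι hadj').2 (by omega)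
            have g2 := (hζ j ι hadj').2 (by omega)
            rw [e1] at hlo2 hhi2
            refine ⟨by omega, le_of_dvd_lt hsι hd (by omega)⟩
        obtain ⟨k, hk, hk'⟩ := this
        exact ⟨k, by rw [hk]; exact so_symm hι, hk'.symm⟩
    have hinj := hr.2.1
    have huniq : ∀ (y : J × ℤ) (k l : Fin L), SameOrbit D.σ (ii k) y.1 →
        y.2 = heightAt D.σ ξ ii k → SameOrbit D.σ (ii l) y.1 → y.2 = heightAt D.σ ξ ii l →
        l = k := by
      intro y k l h1 h2 h3 h4
      have hk := ((im_iff D.σ ξ ii (ii k) y.2).1 ⟨k, rfl, h2.symm⟩).1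
      have hl := ((im_iff D.σ ξ ii (ii l) y.2).1 ⟨l, rfl, h4.symm⟩).1
      have hso := so_trans h1 (so_symm h3)
      have he : ii l = ii k := by
        apply residue_inj hξ hso
        rw [← os_so hso] at hl
        obtain ⟨t, ht⟩ := hk
        obtain ⟨t', ht'⟩ := hl
        exact ⟨t - t', by linear_combination ht - ht'⟩
      exact heightAt_inj D.σ ξ ii l k he (by rw [← h4, ← h2])
    refine ⟨fun b => if h : ∃ k, betaOf C ii k = b then
      v (ii h.choose, heightAt D.σ ξ ii h.choose) else 0, ?_⟩
    have hcoef : ∀ k : Fin L, (if h : ∃ k', betaOf C ii k' = betaOf C ii k then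
      v (ii h.choose, heightAt D.σ ξ ii h.choose) else 0) = v (ii k, heightAt D.σ ξ ii k) := by
      intro k
      have h : ∃ k', betaOf C ii k' = betaOf C ii k := ⟨k, rfl⟩
      rw [dif_pos h, hinj h.choose_spec]
    funext y
    simp only [OmegaQmap, hcoef, Finset.sum_apply, Pi.smul_apply, smul_eq_mul, varpiF]
    by_cases hk : ∃ k : Fin L, SameOrbit D.σ (ii k) y.1 ∧ y.2 = heightAt D.σ ξ ii k
    · obtain ⟨k, hk1, hk2⟩ := hk
      rw [Finset.sum_eq_single k]
      · rw [if_pos ⟨hk1, hk2⟩, mul_one, ← hk2, hv, lroot_invariant hc hk1]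
      · intro l _ hl
        rw [if_neg, mul_zero]
        rintro ⟨h3, h4⟩
        exact hl (huniq y k l hk1 hk2 h3 h4)
      · intro h; exact absurd (Finset.mem_univ k) h
    · have h0 : v y = 0 := by
        by_contra hne
        exact hk (hsupp y hne)
      rw [h0, eq_comm]
      apply Finset.sum_eq_zero
      intro k _
      rw [if_neg (fun e => hk ⟨k, e⟩), mul_zero]

theorem main_lattice {σ : Equiv.Perm J} {ξ : J → ℤ}
    {c : J → J → ℤ} {L : ℕ} {ii : Fin L → J} {x : (J × ℤ) → ℤ}
    (hx : x ∈ AddSubgroup.closure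
          {v : (J × ℤ) → ℤ | ∃ (ι : J) (p : ℤ),
            InImOmega σ ξ ii (ι, p - (orbitSize σ ι : ℤ)) ∧
            InImOmega σ ξ ii (ι, p + (orbitSize σ ι : ℤ)) ∧
            v = lrootF σ c ι p}) :
    x ∈ AddSubgroup.closure (lrootSet σ ξ c) := by
  refine AddSubgroup.closure_mono ?_ hx
  rintro v ⟨ι, p, -, h, rfl⟩
  obtain ⟨t, ht⟩ := ((im_iff _ _ _ _ _).1 h).1
  exact ⟨ι, p, ⟨orbitSize σ ι * t, by rw [ht]; ring⟩, rfl⟩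

theorem main_forward {C : CartanADE J} {D : DiagAut C} {ξ : J → ℤ} (hξ : IsHeightFunction C D ξ)
    {c : J → J → ℤ} (hc : IsFoldedCartan C D.σ c) {L : ℕ} {ii : Fin L → J}
    (ha : IsAdapted C D ξ ii) {x : (J × ℤ) → ℤ} {m : (J → ℤ) → ℤ}
    (hm : x = OmegaQmap C D.σ ξ ii m) (hx : x ∈ AddSubgroup.closure (lrootSet D.σ ξ c)) :
    x ∈ AddSubgroup.closure
          {v : (J × ℤ) → ℤ | ∃ (ι : J) (p : ℤ),
            InImOmega D.σ ξ ii (ι, p - (orbitSize D.σ ι : ℤ)) ∧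
            InImOmega D.σ ξ ii (ι, p + (orbitSize D.σ ι : ℤ)) ∧
            v = lrootF D.σ c ι p} := by
  have hvan : ∀ ι q, (2 * (orbitSize D.σ ι : ℤ)) ∣ q - ξ ι → ¬ InImOmega D.σ ξ ii (ι, q) →
      x (ι, q) = 0 := by
    intro ι q hd hn
    rw [hm]
    simp only [OmegaQmap, Finset.sum_apply, Pi.smul_apply, smul_eq_mul, varpiF]
    apply Finset.sum_eq_zero
    intro k _
    rw [if_neg, mul_zero]
    rintro ⟨h1, h2⟩
    have hk := ((im_iff D.σ ξ ii (ii k) q).1 ⟨k, rfl, h2.symm⟩).1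
    have he : ι = ii k := by
      apply residue_inj hξ h1
      rw [← os_so h1] at hd
      obtain ⟨t, ht⟩ := hk
      obtain ⟨t', ht'⟩ := hd
      exact ⟨t - t', by linear_combination ht - ht'⟩
    exact hn ⟨k, he.symm, h2.symm⟩
  set G : Set (J × ℤ) :=
    {z | (2 * (orbitSize D.σ z.1 : ℤ)) ∣ z.2 + orbitSize D.σ z.1 - ξ z.1} with hG
  have hset : lrootSet D.σ ξ c ⊆ (fun z : J × ℤ => lrootF D.σ c z.1 z.2) '' G := by
    rintro v ⟨ι, p, hp, rfl⟩
    obtain ⟨j, hj, hd⟩ := residue_ex hξ hp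
    refine ⟨(j, p), ?_, (lroot_orbit hc hj p).symm⟩
    simp only [hG, Set.mem_ofPred_eq]
    rw [os_so hj] at hd
    exact hd
  have hx2 := AddSubgroup.closure_mono hset hx
  rw [← Submodule.span_int_eq_addSubgroupClosure, Submodule.mem_toAddSubgroup,
    Finsupp.mem_span_image_iff_linearCombination] at hx2
  obtain ⟨l, hl, hlx⟩ := hx2
  rw [Finsupp.mem_supported] at hl
  have hxy : ∀ y, x y = ∑ z ∈ l.support, l z * lrootF D.σ c z.1 z.2 y := by
    intro y
    rw [← hlx, Finsupp.linearCombination_apply, Finsupp.sum, Finset.sum_apply]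
    rfl
  have hζ := hgt_HH hξ ha L le_rfl
  have hsame : ∀ {j r ι q}, (j, r) ∈ G → SameOrbit D.σ j ι →
      (2 * (orbitSize D.σ ι : ℤ)) ∣ q - ξ ι → (2 * (orbitSize D.σ j : ℤ)) ∣ q - r - orbitSize D.σ j
      → ι = j := by
    intro j r ι q hg hso hd hq
    apply residue_inj hξ hso
    rw [← os_so hso] at hd
    obtain ⟨t, ht⟩ := hg
    obtain ⟨t', ht'⟩ := hd
    obtain ⟨t'', ht''⟩ := hq
    simp only at ht
    exact ⟨t - t' + t'', by linear_combination ht - ht' + ht''⟩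
  have hup : ∀ z ∈ l.support, z.2 + orbitSize D.σ z.1 ≤ ξ z.1 := by
    by_contra hcon
    push Not at hcon
    obtain ⟨z0, hz0, hz0'⟩ := hcon
    obtain ⟨z, hz, hmax⟩ := Finset.exists_max_image
      (l.support.filter fun z => ξ z.1 < z.2 + orbitSize D.σ z.1)
      (fun z => z.2 + (orbitSize D.σ z.1 : ℤ)) ⟨z0, Finset.mem_filter.2 ⟨hz0, hz0'⟩⟩
    simp only [Finset.mem_filter] at hz hmax
    obtain ⟨ι, p⟩ := z
    obtain ⟨hzs, hzv⟩ := hz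
    simp only at hzv hmax
    have hgz := hl hzs
    have hd : (2 * (orbitSize D.σ ι : ℤ)) ∣ p + orbitSize D.σ ι - ξ ι := hgz
    have hs : (0 : ℤ) < orbitSize D.σ ι := by exact_mod_cast os_pos D.σ ι
    have hx0 := hvan ι (p + orbitSize D.σ ι) hd (by
      rw [im_iff]; rintro ⟨-, -, h⟩; omega)
    have hge : ξ ι + 2 * orbitSize D.σ ι ≤ p + orbitSize D.σ ι := by
      by_contra hcon
      have := le_of_dvd_lt hs hd (by omega)
      omega
    rw [hxy, Finset.sum_eq_single (ι, p)] at hx0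
    · rw [lroot_top, mul_one] at hx0
      exact (Finsupp.mem_support_iff.1 hzs) hx0
    · rintro ⟨j, r⟩ hjs hne
      by_contra hcon
      have hne0 : lrootF D.σ c j r (ι, p + orbitSize D.σ ι) ≠ 0 := fun h => hcon (by rw [h, mul_zero])
      have hgj := hl hjs
      have hsj : (0 : ℤ) < orbitSize D.σ j := by exact_mod_cast os_pos D.σ j
      rcases lroot_ne hne0 with ⟨h1, h2⟩ | ⟨h1, h2⟩ | ⟨hns, k, hk1, hk2, hk3⟩
      · simp only at h1 h2
        have he := hsame hgj h1 hd ⟨0, by rw [h2]; ring⟩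
        subst he
        exact hne (by rw [Prod.mk.injEq]; exact ⟨rfl, by omega⟩)
      · simp only at h1 h2
        have he := hsame hgj h1 hd ⟨-1, by rw [h2]; ring⟩
        subst he
        have := hmax (ι, r) ⟨hjs, by simp only; omega⟩
        simp only at this
        omega
      · obtain ⟨ι', hι', hd', hadj, hcase⟩ := middle hξ hc hgj hns hk1 hk2 hk3
        simp only at hι' hd' hadj hcase
        have he : ι' = ι := by
          apply residue_inj hξ hι'
          rw [← os_so hι'] at hd'
          obtain ⟨t, ht⟩ := hd
          obtain ⟨t', ht'⟩ := hd'
          exact ⟨t - t', by linear_combination ht - ht'⟩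
        subst he
        have hadj' : C.a j ι' = -1 := by rw [C.symm]; exact hadj
        have hcl : ξ j < r + orbitSize D.σ j ∧
            p + orbitSize D.σ ι' < r + orbitSize D.σ j := by
          rcases hcase with ⟨e1, e2⟩ | ⟨e1, e2, e3, e4⟩ | ⟨e1, e2, e3⟩
          · have g1 := abs_le.1 ((HH_init hξ ι' j hadj).1 e1).le
            exact ⟨by omega, by omega⟩
          · have g1 := (HH_init hξ ι' j hadj).2 (by omega)
            exact ⟨by omega, by omega⟩
          · have g1 := (HH_init hξ j ι' hadj').2 (by omega)
            exact ⟨by omega, by omega⟩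
        have := hmax (j, r) ⟨hjs, hcl.1⟩
        simp only at this
        omega
    · intro h; exact absurd hzs h
  have hlow : ∀ z ∈ l.support, hgt D.σ ξ ii L z.1 < z.2 - orbitSize D.σ z.1 := by
    set ζ := hgt D.σ ξ ii L with hζdef
    by_contra hcon
    push Not at hcon
    obtain ⟨z0, hz0, hz0'⟩ := hcon
    obtain ⟨z, hz, hmin⟩ := Finset.exists_min_image
      (l.support.filter fun z => z.2 - orbitSize D.σ z.1 ≤ ζ z.1)
      (fun z => z.2 - (orbitSize D.σ z.1 : ℤ)) ⟨z0, Finset.mem_filter.2 ⟨hz0, hz0'⟩⟩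
    simp only [Finset.mem_filter] at hz hmin
    obtain ⟨ι, p⟩ := z
    obtain ⟨hzs, hzv⟩ := hz
    simp only at hzv hmin
    have hgz := hl hzs
    have hd : (2 * (orbitSize D.σ ι : ℤ)) ∣ p - orbitSize D.σ ι - ξ ι := by
      obtain ⟨t, ht⟩ := hgz
      simp only at ht
      exact ⟨t - 1, by linear_combination ht⟩
    have hs : (0 : ℤ) < orbitSize D.σ ι := by exact_mod_cast os_pos D.σ ι
    have hx0 := hvan ι (p - orbitSize D.σ ι) hd (by
      rw [im_iff, ← hζdef]; rintro ⟨-, h, -⟩; omega)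
    rw [hxy, Finset.sum_eq_single (ι, p)] at hx0
    · rw [lroot_bot, mul_one] at hx0
      exact (Finsupp.mem_support_iff.1 hzs) hx0
    · rintro ⟨j, r⟩ hjs hne
      by_contra hcon
      have hne0 : lrootF D.σ c j r (ι, p - orbitSize D.σ ι) ≠ 0 := fun h => hcon (by rw [h, mul_zero])
      have hgj := hl hjs
      have hsj : (0 : ℤ) < orbitSize D.σ j := by exact_mod_cast os_pos D.σ j
      rcases lroot_ne hne0 with ⟨h1, h2⟩ | ⟨h1, h2⟩ | ⟨hns, k, hk1, hk2, hk3⟩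
      · simp only at h1 h2
        have he := hsame hgj h1 hd ⟨0, by rw [h2]; ring⟩
        subst he
        have := hmin (ι, r) ⟨hjs, by simp only; omega⟩
        simp only at this
        omega
      · simp only at h1 h2
        have he := hsame hgj h1 hd ⟨-1, by rw [h2]; ring⟩
        subst he
        exact hne (by rw [Prod.mk.injEq]; exact ⟨rfl, by omega⟩)
      · obtain ⟨ι', hι', hd', hadj, hcase⟩ := middle hξ hc hgj hns hk1 hk2 hk3
        simp only at hι' hd' hadj hcase
        have he : ι' = ι := by
          apply residue_inj hξ hι'
          rw [← os_so hι'] at hd'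
          obtain ⟨t, ht⟩ := hd
          obtain ⟨t', ht'⟩ := hd'
          exact ⟨t - t', by linear_combination ht - ht'⟩
        subst he
        have hadj' : C.a j ι' = -1 := by rw [C.symm]; exact hadj
        have hcl : r - orbitSize D.σ j ≤ ζ j ∧
            r - orbitSize D.σ j < p - orbitSize D.σ ι' := by
          rcases hcase with ⟨e1, e2⟩ | ⟨e1, e2, e3, e4⟩ | ⟨e1, e2, e3⟩
          · have g1 := abs_le.1 ((hζ ι' j hadj).1 e1).le
            exact ⟨by omega, by omega⟩
          · have g1 := (hζ ι' j hadj).2 (by omega)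
            have hdj : (2 * (orbitSize D.σ j : ℤ)) ∣ (r - orbitSize D.σ j) - ζ j := by
              obtain ⟨t, ht⟩ := hgj
              obtain ⟨t', ht'⟩ : (2 * (orbitSize D.σ j : ℤ)) ∣ ζ j - ξ j :=
                (hgt_mem D.σ ξ ii j L le_rfl).1
              simp only at ht
              exact ⟨t - t' - 1, by linear_combination ht - ht'⟩
            exact ⟨le_of_dvd_lt hsj hdj (by omega), by omega⟩
          · have g1 := (hζ j ι' hadj').2 (by omega)
            exact ⟨by omega, by omega⟩
        have := hmin (j, r) ⟨hjs, hcl.1⟩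
        simp only at this
        omega
    · intro h; exact absurd hzs h
  have hxs : x = ∑ z ∈ l.support, l z • lrootF D.σ c z.1 z.2 := by
    rw [← hlx, Finsupp.linearCombination_apply, Finsupp.sum]
  rw [hxs]
  refine AddSubgroup.sum_mem _ fun z hz => AddSubgroup.zsmul_mem _ (AddSubgroup.subset_closure ?_) _
  have hs : (0 : ℤ) < orbitSize D.σ z.1 := by exact_mod_cast os_pos D.σ z.1
  have h1 := hup z hz
  have h2 := hlow z hz
  have hg : (2 * (orbitSize D.σ z.1 : ℤ)) ∣ z.2 + orbitSize D.σ z.1 - ξ z.1 := hl hz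
  refine ⟨z.1, z.2, (im_iff _ _ _ _ _).2 ⟨?_, h2, by omega⟩,
    (im_iff _ _ _ _ _).2 ⟨hg, by omega, h1⟩, rfl⟩
  obtain ⟨t, ht⟩ := hg
  exact ⟨t - 1, by linear_combination ht⟩

/-- Lemma 6.4: `𝒫_Q ∩ 𝒬_ℤ = ⊕_{(i,p) ∈ K̂} ℤ α_{i,p}`: an element lies
both in the image of `Ω_Q` and in the subgroup generated by all ℓ-roots iff it is a
ℤ-linear combination of the ℓ-roots `α_{i,p}` with `(i,p) ∈ K̂`. -/
theorem statement11 (C : CartanADE J) (D : DiagAut C) (ξ : J → ℤ)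
    (hξ : IsHeightFunction C D ξ)
    (c : J → J → ℤ) (hc : IsFoldedCartan C D.σ c)
    (L : ℕ) (ii : Fin L → J) (hr : IsReducedWord C ii) (ha : IsAdapted C D ξ ii) :
    ∀ x : (J × ℤ) → ℤ,
      ((∃ m : (J → ℤ) → ℤ, x = OmegaQmap C D.σ ξ ii m) ∧
          x ∈ AddSubgroup.closure (lrootSet D.σ ξ c)) ↔
        x ∈ AddSubgroup.closure
          {v : (J × ℤ) → ℤ | ∃ (ι : J) (p : ℤ),
            InImOmega D.σ ξ ii (ι, p - (orbitSize D.σ ι : ℤ)) ∧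
            InImOmega D.σ ξ ii (ι, p + (orbitSize D.σ ι : ℤ)) ∧
            v = lrootF D.σ c ι p} := by
  intro x
  constructor
  · rintro ⟨⟨m, hm⟩, hx⟩
    exact main_forward hξ hc ha hm hx
  · intro hx
    exact ⟨main_range hξ hc hr ha hx, main_lattice hx⟩

end QDatumPaper
end
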